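/- For every real ℓ > 0, the mean ℓ displacement over the corner vertices satisfies lim_{n→∞} n·ξ'(n,ℓ)/2^{nℓ} = 1 + (1 + (√3/2)^ℓ)/(2(2^ℓ − 1)). -/

import Mathlib

open scoped Classical
open Filter Topology

noncomputable section

namespace SierpinskiGasket

/-- √3 -/
def sq3 : ℝ := Real.sqrt 3

/-- the origin, leftmost outmost vertex of every `SG n` -/
def o : ℝ × ℝ := (0, 0)

/-- `a m = (2^m, 0)`, the rightmost vertex of `SG m` (also a translation vector). -/
def a (m : ℕ) : ℝ × ℝ := ((2:ℝ) ^ m, 0)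

/-- `b m = (2^(m-1), 2^(m-1)·√3)`, the topmost vertex of `SG m`. -/
def b (m : ℕ) : ℝ × ℝ := ((2:ℝ) ^ m / 2, (2:ℝ) ^ m / 2 * sq3)

/-- `c m = (3·2^(m-1), 2^(m-1)·√3)`. -/
def c (m : ℕ) : ℝ × ℝ := (3 * (2:ℝ) ^ m / 2, (2:ℝ) ^ m / 2 * sq3)

/-- vertex set of `SG n` -/
def V : ℕ → Set (ℝ × ℝ)
  | 0 => {o, a 0, b 0}
  | n + 1 => V n ∪ ((· + a n) '' V n) ∪ ((· + b n) '' V n)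

/-- edge set of `SG n` -/
def E : ℕ → Set (Sym2 (ℝ × ℝ))
  | 0 => {s(o, a 0), s(o, b 0), s(a 0, b 0)}
  | n + 1 => E n ∪ (Sym2.map (· + a n) '' E n) ∪ (Sym2.map (· + b n) '' E n)

/-- `SG n` as a simple graph on `ℝ × ℝ` -/
def G (n : ℕ) : SimpleGraph (ℝ × ℝ) := SimpleGraph.fromEdgeSet (E n)

/-- a Hamiltonian path of `SG n`: a path visiting every vertex of `SG n` exactly once -/
def IsHamPath (n : ℕ) {u v : ℝ × ℝ} (p : (G n).Walk u v) : Prop :=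
  p.IsPath ∧ ∀ x, x ∈ p.support ↔ x ∈ V n

/-- a Hamiltonian cycle of `SG n` -/
def IsHamCycle (n : ℕ) {u : ℝ × ℝ} (p : (G n).Walk u u) : Prop :=
  p.IsCycle ∧ ∀ x, x ∈ p.support ↔ x ∈ V n

/-- `f n u v`: the number of Hamiltonian paths of `SG n` with end-vertex set `{u, v}`
(for `u ≠ v`, such unordered paths correspond bijectively to walks from `u` to `v`). -/
def f (n : ℕ) (u v : ℝ × ℝ) : ℕ := Nat.card {p : (G n).Walk u v // IsHamPath n p}

/-- `f1 n`: the number of Hamiltonian paths of `SG n` with end-vertex set `{o, a n}` -/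
def f1 (n : ℕ) : ℕ := f n o (a n)

/-- the number of Hamiltonian cycles of `SG n`, counted up to starting vertex and
orientation: every Hamiltonian cycle passes through `o` and has exactly two
representatives as a closed walk based at `o`. -/
def HC (n : ℕ) : ℕ := Nat.card {p : (G n).Walk o o // IsHamCycle n p} / 2

/-- the number of Hamiltonian paths of `SG n` having `o` as one of their end vertices -/
def H0 (n : ℕ) : ℕ := ∑ᶠ x ∈ {x : ℝ × ℝ | x ≠ o}, f n o x

/-- the total number of Hamiltonian paths of `SG n` (a path and its reversal
are the same unordered object, whence the division by `2`). -/
def H (n : ℕ) : ℕ := (∑ᶠ u : ℝ × ℝ, ∑ᶠ v : ℝ × ℝ, f n u v) / 2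

/-- the distribution ratio `F(n,x) = f(n,x)/f1(n)` -/
def F (n : ℕ) (x : ℝ × ℝ) : ℝ := (f n o x : ℝ) / (f1 n : ℝ)

/-- `SG n` with the vertex `b n` (and its incident edges) deleted -/
def Gd (n : ℕ) : SimpleGraph (ℝ × ℝ) := SimpleGraph.fromEdgeSet {e ∈ E n | b n ∉ e}

/-- Hamiltonian path of `SG n - b n` -/
def IsHamPathD (n : ℕ) {u v : ℝ × ℝ} (p : (Gd n).Walk u v) : Prop :=
  p.IsPath ∧ ∀ x, x ∈ p.support ↔ (x ∈ V n ∧ x ≠ b n)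

/-- `g2 n x`: the number of Hamiltonian paths of `SG n - b n` with end-vertex set `{o, x}` -/
def g2 (n : ℕ) (x : ℝ × ℝ) : ℕ := Nat.card {p : (Gd n).Walk o x // IsHamPathD n p}

/-- `g1 n`: the number of Hamiltonian paths of `SG n - b n` with end-vertex set `{o, a n}` -/
def g1 (n : ℕ) : ℕ := g2 n (a n)

/-- the distribution ratio `G₂(n,x) = g₂(n,x)/g₁(n)` -/
def G2 (n : ℕ) (x : ℝ × ℝ) : ℝ := (g2 n x : ℝ) / (g1 n : ℝ)

/-- mid-side vertex `a_{m,1} = (3·2^(m-1), 0)` -/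
def a1 (m : ℕ) : ℝ × ℝ := (3 * (2:ℝ) ^ m / 2, 0)

/-- mid-side vertex `b_{m,1} = (5·2^(m-2), 2^(m-2)·√3)` -/
def b1 (m : ℕ) : ℝ × ℝ := (5 * (2:ℝ) ^ m / 4, (2:ℝ) ^ m / 4 * sq3)

/-- mid-side vertex `c_{m,1} = (7·2^(m-2), 2^(m-2)·√3)` -/
def c1 (m : ℕ) : ℝ × ℝ := (7 * (2:ℝ) ^ m / 4, (2:ℝ) ^ m / 4 * sq3)

/-- mid-side vertex `a_{m,2} = (2^m, 2^(m-1)·√3)` -/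
def a2 (m : ℕ) : ℝ × ℝ := ((2:ℝ) ^ m, (2:ℝ) ^ m / 2 * sq3)

/-- mid-side vertex `b_{m,2} = (3·2^(m-2), 3·2^(m-2)·√3)` -/
def b2 (m : ℕ) : ℝ × ℝ := (3 * (2:ℝ) ^ m / 4, 3 * (2:ℝ) ^ m / 4 * sq3)

/-- mid-side vertex `c_{m,2} = (5·2^(m-2), 3·2^(m-2)·√3)` -/
def c2 (m : ℕ) : ℝ × ℝ := (5 * (2:ℝ) ^ m / 4, 3 * (2:ℝ) ^ m / 4 * sq3)

/-- exceptional vertex `a* = (2^(n-1), (2^(n-1)-1)·√3)` -/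
def astar (n : ℕ) : ℝ × ℝ := ((2:ℝ) ^ n / 2, ((2:ℝ) ^ n / 2 - 1) * sq3)

/-- exceptional vertex `b* = (2^(n-1) - 1/2, (2^n-1)·√3/2)` -/
def bstar (n : ℕ) : ℝ × ℝ := ((2:ℝ) ^ n / 2 - 1/2, ((2:ℝ) ^ n - 1) * sq3 / 2)

/-- exceptional vertex `c* = (2^(n-1) + 1/2, (2^n-1)·√3/2)` -/
def cstar (n : ℕ) : ℝ × ℝ := ((2:ℝ) ^ n / 2 + 1/2, ((2:ℝ) ^ n - 1) * sq3 / 2)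

/-- the Euclidean norm on `ℝ × ℝ` -/
def enorm (x : ℝ × ℝ) : ℝ := Real.sqrt (x.1 ^ 2 + x.2 ^ 2)

/-- the set `C n` of corner vertices of `SG n` -/
def C (n : ℕ) : Finset (ℝ × ℝ) :=
  ((Finset.range (n + 1)).image a) ∪ ((Finset.range (n + 1)).image b) ∪
    ((Finset.range n).image c)

/-- the mean `ℓ` displacement over the corner vertices -/
def xi' (n : ℕ) (ℓ : ℝ) : ℝ :=
  (∑ x ∈ C n, enorm x ^ ℓ * F n x) / (∑ x ∈ C n, F n x)

/-- `p(n,x)`: the probability that a Hamiltonian path with one end at `o`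
has its other end at `x` -/
def p (n : ℕ) (x : ℝ × ℝ) : ℝ := (f n o x : ℝ) / (H0 n : ℝ)

/-- the mean `ℓ` displacement of Hamiltonian paths on `SG n` with one end at `o` -/
def xi (n : ℕ) (ℓ : ℝ) : ℝ :=
  ∑ᶠ x ∈ {x : ℝ × ℝ | x ∈ V n ∧ x ≠ o}, enorm x ^ ℓ * p n x

/-- the partition function of Hamiltonian paths on `SG n` -/
def Z (n : ℕ) (β : ℝ) : ℝ := (H n : ℝ) * Real.exp (-(β * ((3 ^ (n + 1) + 1) / 2)))

section Paths

variable {α : Type*}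

/-- Three relations `AL`, `AT`, `AR` living on vertex sets `L`, `T`, `R` that pairwise meet in
exactly one vertex (`a` for `L, R`, `b` for `L, T`, `c` for `T, R`), with union `A`. -/
structure Ring (A AL AT AR : α → α → Prop) (L T R : Set α) (a b c : α) : Prop where
  adj : ∀ x y, A x y ↔ AL x y ∨ AT x y ∨ AR x y
  left : ∀ x y, AL x y → x ∈ L ∧ y ∈ L
  top : ∀ x y, AT x y → x ∈ T ∧ y ∈ T
  right : ∀ x y, AR x y → x ∈ R ∧ y ∈ R
  left_top : ∀ x, x ∈ L ∧ x ∈ T ↔ x = b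
  left_right : ∀ x, x ∈ L ∧ x ∈ R ↔ x = a
  top_right : ∀ x, x ∈ T ∧ x ∈ R ↔ x = c
  ab : a ≠ b
  ac : a ≠ c
  bc : b ≠ c

namespace Ring

variable {A AL AT AR : α → α → Prop} {L T R : Set α} {a b c : α}

lemma mirror (h : Ring A AL AT AR L T R a b c) : Ring A AL AR AT L R T b a c where
  adj x y := by rw [h.adj]; tauto
  left := h.left
  top := h.right
  right := h.top
  left_top := h.left_right
  left_right := h.left_top
  top_right x := by rw [and_comm, h.top_right]
  ab := h.ab.symm
  ac := h.bc
  bc := h.ac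

lemma rotate (h : Ring A AL AT AR L T R a b c) : Ring A AT AR AL T R L b c a where
  adj x y := by rw [h.adj]; tauto
  left := h.top
  top := h.right
  right := h.left
  left_top := h.top_right
  left_right x := by rw [and_comm, h.left_top]
  top_right x := by rw [and_comm, h.left_right]
  ab := h.bc
  ac := h.ab.symm
  bc := h.ac.symm

end Ring

lemma mem_of_isChain {B : α → α → Prop} {X : Set α} (hB : ∀ x y, B x y → x ∈ X ∧ y ∈ X)
    {u : α} {l : List α} (hu : u ∈ X) (h : (u :: l).IsChain B) : ∀ y ∈ u :: l, y ∈ X := by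
  induction l generalizing u with
  | nil => simpa using hu
  | cons v l ih =>
    rw [List.isChain_cons_cons] at h
    have := ih (hB _ _ h.1).2 h.2
    simp_all

/-- A chain of `A` is a chain of `B` up to the first step that is not one of `B`. -/
lemma isChain_or_exit {A : α → α → Prop} (B : α → α → Prop) {u : α} {l : List α}
    (h : (u :: l).IsChain A) :
    (u :: l).IsChain B ∨ ∃ p s t q, u :: l = p ++ s :: t :: q ∧ (p ++ [s]).IsChain B ∧
      A s t ∧ ¬ B s t := by
  induction l generalizing u with
  | nil => simp
  | cons v l ih =>
    rw [List.isChain_cons_cons] at h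
    by_cases hB : B u v
    · rcases ih h.2 with h' | ⟨p, s, t, q, e, h1, h2, h3⟩
      · left; simp [hB, h']
      · right
        refine ⟨u :: p, s, t, q, by simp [e], ?_, h2, h3⟩
        cases p with
        | nil =>
          obtain ⟨rfl, -⟩ := List.cons.inj e
          simpa using hB
        | cons w p =>
          obtain ⟨rfl, -⟩ := List.cons.inj e
          exact List.isChain_cons_cons.2 ⟨hB, h1⟩
    · right
      exact ⟨[], u, v, l, rfl, by simp, h.1, hB⟩

namespace Ring

variable {A AL AT AR : α → α → Prop} {L T R : Set α} {a b c : α}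

lemma exit (h : Ring A AL AT AR L T R a b c) {u : α} {l : List α} (hu : u ∈ L)
    (hl : (u :: l).IsChain A) :
    (u :: l).IsChain AL ∨
      (∃ p t q, u :: l = p ++ b :: t :: q ∧ (p ++ [b]).IsChain AL ∧ AT b t) ∨
      (∃ p t q, u :: l = p ++ a :: t :: q ∧ (p ++ [a]).IsChain AL ∧ AR a t) := by
  rcases isChain_or_exit AL hl with h' | ⟨p, s, t, q, e, h1, h2, h3⟩
  · exact .inl h'
  have hs : s ∈ L := by
    cases p with
    | nil => simp at e; exact e.1 ▸ hu
    | cons w p =>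
      simp at e
      obtain ⟨rfl, -⟩ := e
      exact mem_of_isChain h.left hu h1 s (by simp)
  rcases (h.adj s t).1 h2 with h4 | h4 | h4
  · exact absurd h4 h3
  · obtain rfl := (h.left_top s).1 ⟨hs, (h.top _ _ h4).1⟩
    exact .inr (.inl ⟨p, t, q, e, h1, h4⟩)
  · obtain rfl := (h.left_right s).1 ⟨hs, (h.right _ _ h4).1⟩
    exact .inr (.inr ⟨p, t, q, e, h1, h4⟩)

/-- A path that enters `T` through `b` either stays in `T` or leaves it through `c`. -/
lemma pass (h : Ring A AL AT AR L T R a b c) {t : α} {l : List α}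
    (hl : (b :: t :: l).IsChain A) (hd : (b :: t :: l).Nodup) (hbt : AT b t) :
    (b :: t :: l).IsChain AT ∨
      ∃ m s q, t :: l = m ++ c :: s :: q ∧ (b :: (m ++ [c])).IsChain AT ∧ AR c s := by
  rcases h.rotate.exit (h.top _ _ hbt).1 hl with h' | ⟨p, s, q, e, h1, h2⟩ | ⟨p, s, q, e, h1, h2⟩
  · exact .inl h'
  · right
    cases p with
    | nil => exact absurd (List.cons.inj e).1 h.bc
    | cons w p =>
      simp only [List.cons_append, List.cons.injEq] at e
      obtain ⟨rfl, e⟩ := e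
      exact ⟨p, s, q, e, h1, h2⟩
  · cases p with
    | nil =>
      simp at e
      obtain ⟨rfl, rfl⟩ := e
      have := (h.left_top t).1 ⟨(h.left _ _ h2).2, (h.top _ _ hbt).2⟩
      simp [this] at hd
    | cons w p =>
      simp only [List.cons_append, List.cons.injEq] at e
      rw [e.2] at hd
      simp at hd

/-- The possible courses of a path that enters `T` through `b` after having started in `L`. -/
lemma course (h : Ring A AL AT AR L T R a b c) {t : α} {l : List α}
    (hl : (b :: t :: l).IsChain A) (hd : (b :: t :: l).Nodup) (hbt : AT b t) :
    (b :: t :: l).IsChain AT ∨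
      ∃ m l', t :: l = m ++ c :: l' ∧ (b :: (m ++ [c])).IsChain AT ∧
        ((c :: l').IsChain AR ∨
          ∃ r q, l' = r ++ a :: q ∧ (c :: (r ++ [a])).IsChain AR ∧ (a :: q).IsChain AL) := by
  rcases h.pass hl hd hbt with h' | ⟨m, s, q, e, h1, h2⟩
  · exact .inl h'
  refine .inr ⟨m, s :: q, e, h1, ?_⟩
  rw [e] at hl hd
  have hl2 : (c :: s :: q).IsChain A := by
    rw [← List.cons_append, List.isChain_split] at hl
    exact hl.2
  have hd2 : (c :: s :: q).Nodup := by
    rw [← List.cons_append, List.nodup_append] at hd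
    exact hd.2.1
  rcases h.rotate.pass hl2 hd2 h2 with h' | ⟨r, s', q', e', h3, h4⟩
  · exact .inl h'
  refine .inr ⟨r, s' :: q', e', h3, ?_⟩
  rw [e'] at hl2 hd2 hd
  have hl3 : (a :: s' :: q').IsChain A := by
    rw [← List.cons_append, List.isChain_split] at hl2
    exact hl2.2
  have hd3 : (a :: s' :: q').Nodup := by
    rw [← List.cons_append, List.nodup_append] at hd2
    exact hd2.2.1
  rcases h.rotate.rotate.pass hl3 hd3 h4 with h' | ⟨r', s'', q'', e'', -, -⟩
  · exact h'
  · rw [e''] at hd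
    simp at hd

/-- A path whose first vertex lies in `L` and which leaves `L` towards `T` does so as in
`Ring.course`. -/
def Via (AL AT AR : α → α → Prop) (a b c o : α) (l : List α) : Prop :=
  ∃ p l', l = p ++ b :: l' ∧ (o :: (p ++ [b])).IsChain AL ∧
    ((b :: l').IsChain AT ∨
      ∃ m l'', l' = m ++ c :: l'' ∧ (b :: (m ++ [c])).IsChain AT ∧
        ((c :: l'').IsChain AR ∨
          ∃ r q, l'' = r ++ a :: q ∧ (c :: (r ++ [a])).IsChain AR ∧ (a :: q).IsChain AL))

lemma via_aux (h : Ring A AL AT AR L T R a b c) {o : α} {l p : List α} {t : α} {q : List α}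
    (hob : o ≠ b) (hl : (o :: l).IsChain A) (hd : (o :: l).Nodup)
    (e : o :: l = p ++ b :: t :: q) (h1 : (p ++ [b]).IsChain AL) (h2 : AT b t) :
    Via AL AT AR a b c o l := by
  cases p with
  | nil => exact absurd (List.cons.inj e).1 hob
  | cons w p =>
    simp only [List.cons_append, List.cons.injEq] at e
    obtain ⟨rfl, rfl⟩ := e
    refine ⟨p, t :: q, rfl, h1, h.course ?_ ?_ h2⟩
    · rw [← List.cons_append, List.isChain_split] at hl
      exact hl.2
    · rw [← List.cons_append, List.nodup_append] at hd
      exact hd.2.1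

lemma via (h : Ring A AL AT AR L T R a b c) {o : α} {l : List α} (ho : o ∈ L)
    (hob : o ≠ b) (hoa : o ≠ a) (hl : (o :: l).IsChain A) (hd : (o :: l).Nodup) :
    (o :: l).IsChain AL ∨ Via AL AT AR a b c o l ∨ Via AL AR AT b a c o l := by
  rcases h.exit ho hl with h' | ⟨p, t, q, e, h1, h2⟩ | ⟨p, t, q, e, h1, h2⟩
  · exact .inl h'
  · exact .inr (.inl (h.via_aux hob hl hd e h1 h2))
  · exact .inr (.inr (h.mirror.via_aux hoa hl hd e h1 h2))

end Ring

/-- The lists `l` such that `u :: l` is a path of `A` from `u` to `v` with vertex set `W`. -/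
def Tails (A : α → α → Prop) (u v : α) (W : Set α) : Set (List α) :=
  {l | (u :: l).IsChain A ∧ (u :: l).Nodup ∧ (∀ y, y ∈ u :: l ↔ y ∈ W) ∧
    (u :: l).getLast? = some v}

/-- The lists `m` such that `u, m, v` is a path of `A` from `u` to `v` with vertex set `W`. -/
def Mids (A : α → α → Prop) (u v : α) (W : Set α) : Set (List α) :=
  {m | (u :: (m ++ [v])).IsChain A ∧ (u :: (m ++ [v])).Nodup ∧
    ∀ y, y ∈ u :: (m ++ [v]) ↔ y ∈ W}

/-- The pairs `(p, q)` such that `u, p, v` and `w, q` are disjoint paths of `A`, the second one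
ending at `x`, with `W` the set of all vertices visited. -/
def Pairs (A : α → α → Prop) (u v w x : α) (W : Set α) : Set (List α × List α) :=
  {z | (u :: (z.1 ++ [v])).IsChain A ∧ (w :: z.2).IsChain A ∧
    (u :: (z.1 ++ v :: w :: z.2)).Nodup ∧ (∀ y, y ∈ u :: (z.1 ++ v :: w :: z.2) ↔ y ∈ W) ∧
    (w :: z.2).getLast? = some x}

lemma finite_nodup {W : Set α} (hW : W.Finite) :
    {l : List α | l.Nodup ∧ ∀ y ∈ l, y ∈ W}.Finite := by
  classical
  have := hW.fintype
  have h1 : {l : List W | l.length ≤ Fintype.card W}.Finite := List.finite_length_le _ _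
  refine (h1.image (List.map Subtype.val)).subset ?_
  rintro l ⟨h2, h3⟩
  lift l to List W using h3
  refine ⟨l, ?_, rfl⟩
  exact (List.Nodup.of_map _ h2).length_le_card

lemma finite_tails {A : α → α → Prop} {u v : α} {W : Set α} (hW : W.Finite) :
    (Tails A u v W).Finite :=
  (finite_nodup hW).subset fun _ hl ↦
    ⟨hl.2.1.of_cons, fun y hy ↦ (hl.2.2.1 y).1 (List.mem_cons_of_mem _ hy)⟩

lemma finite_mids {A : α → α → Prop} {u v : α} {W : Set α} (hW : W.Finite) :
    (Mids A u v W).Finite := by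
  refine (finite_nodup hW).subset fun _ hl ↦ ⟨?_, fun y hy ↦ (hl.2.2 y).1 (by simp [hy])⟩
  have := hl.2.1.of_cons
  rw [List.nodup_append] at this
  exact this.1

lemma finite_pairs {A : α → α → Prop} {u v w x : α} {W : Set α} (hW : W.Finite) :
    (Pairs A u v w x W).Finite := by
  refine ((finite_nodup hW).prod (finite_nodup hW)).subset ?_
  rintro ⟨p, q⟩ ⟨-, -, h, h', -⟩
  refine ⟨⟨?_, fun y hy ↦ (h' y).1 (by simp [hy])⟩, ⟨?_, fun y hy ↦ (h' y).1 (by simp [hy])⟩⟩ <;>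
    grind

lemma ncard_mids {A : α → α → Prop} {u v : α} (huv : u ≠ v) (W : Set α) :
    (Mids A u v W).ncard = (Tails A u v W).ncard := by
  have : Tails A u v W = (fun m ↦ m ++ [v]) '' Mids A u v W := by
    ext l
    constructor
    · rintro ⟨h1, h2, h3, h4⟩
      rcases List.eq_nil_or_concat l with rfl | ⟨m, w, rfl⟩
      · simp at h4; exact absurd h4 huv
      · rw [List.getLast?_eq_some_iff] at h4
        obtain ⟨k, hk⟩ := h4
        have : w = v := by
          have := congrArg List.getLast? hk
          simpa [List.getLast?_cons] using this
        subst this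
        refine ⟨m, ⟨by simpa using h1, by simpa using h2, by simpa using h3⟩, by simp⟩
    · rintro ⟨m, ⟨h1, h2, h3⟩, rfl⟩
      exact ⟨h1, h2, h3, by simp [List.getLast?_cons]⟩
  rw [this, Set.InjOn.ncard_image]
  exact fun x _ y _ h ↦ List.append_cancel_right h

lemma isChain_glue {A : α → α → Prop} {u s : α} {p q : List α} (hp : (u :: (p ++ [s])).IsChain A)
    (hq : (s :: q).IsChain A) : (u :: (p ++ s :: q)).IsChain A := by
  rw [← List.cons_append, List.isChain_split]
  exact ⟨hp, hq⟩

lemma split_unique {s : α} {p q p' q' : List α} (hd : (p ++ s :: q).Nodup)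
    (e : p ++ s :: q = p' ++ s :: q') : p = p' ∧ q = q' := by
  have := (List.append_cons_inj_of_notMem (by grind) (by grind)).1 e
  exact ⟨this.1, this.2.2⟩

namespace Ring

variable {A AL AT AR : α → α → Prop} {L T R : Set α} {a b c : α}

lemma glue (h : Ring A AL AT AR L T R a b c) :
    (∀ x y, AL x y → A x y) ∧ (∀ x y, AT x y → A x y) ∧ (∀ x y, AR x y → A x y) :=
  ⟨fun x y h' ↦ (h.adj x y).2 (.inl h'), fun x y h' ↦ (h.adj x y).2 (.inr (.inl h')),
    fun x y h' ↦ (h.adj x y).2 (.inr (.inr h'))⟩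

/-- The path that runs through `L`, `T`, `R` and then `L` again. -/
def loop (b c a : α) (z : (List α × List α) × List α × List α) : List α :=
  z.1.1 ++ b :: (z.2.1 ++ c :: (z.2.2 ++ a :: z.1.2))

lemma loop_mem (h : Ring A AL AT AR L T R a b c) {o x : α}
    {z : (List α × List α) × List α × List α}
    (hz : z ∈ Pairs AL o b a x L ×ˢ Mids AT b c T ×ˢ Mids AR c a R) :
    loop b c a z ∈ Tails A o x (L ∪ T ∪ R) := by
  obtain ⟨⟨p, q⟩, m, r⟩ := z
  obtain ⟨⟨h1, h2, h3, h4, h5⟩, ⟨h6, h7, h8⟩, h9, h10, h11⟩ := hz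
  dsimp only [loop] at *
  obtain ⟨gL, gT, gR⟩ := h.glue
  have lt := h.left_top
  have lr := h.left_right
  have tr := h.top_right
  refine ⟨?_, ?_, ?_, ?_⟩
  · exact isChain_glue (h1.imp gL) (isChain_glue (h6.imp gT) (isChain_glue (h9.imp gR) (h2.imp gL)))
  · simp only [List.nodup_cons, List.nodup_append, List.mem_append, List.mem_cons] at *
    grind
  · simp only [List.nodup_cons, List.nodup_append, List.mem_append, List.mem_cons,
      Set.mem_union] at *
    grind
  · simp only [List.getLast?_cons, List.getLast?_append] at h5 ⊢
    grind

lemma mem_of_loop_mem (h : Ring A AL AT AR L T R a b c) {o x : α} (ho : o ∈ L)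
    {p q m r : List α} (hl : loop b c a ((p, q), m, r) ∈ Tails A o x (L ∪ T ∪ R))
    (h1 : (o :: (p ++ [b])).IsChain AL) (h2 : (b :: (m ++ [c])).IsChain AT)
    (h3 : (c :: (r ++ [a])).IsChain AR) (h4 : (a :: q).IsChain AL) :
    ((p, q), m, r) ∈ Pairs AL o b a x L ×ˢ Mids AT b c T ×ˢ Mids AR c a R := by
  obtain ⟨-, hd, hm, hx⟩ := hl
  dsimp only [loop] at *
  have lt := h.left_top
  have lr := h.left_right
  have tr := h.top_right
  have m1 := mem_of_isChain h.left ho h1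
  have m2 := mem_of_isChain h.top ((lt b).2 rfl).2 h2
  have m3 := mem_of_isChain h.right ((tr c).2 rfl).2 h3
  have m4 := mem_of_isChain h.left ((lr a).2 rfl).1 h4
  refine ⟨⟨h1, h4, ?_, ?_, ?_⟩, ⟨h2, ?_, ?_⟩, h3, ?_, ?_⟩
  · simp only [List.nodup_cons, List.nodup_append, List.mem_append, List.mem_cons] at *
    grind
  · simp only [List.nodup_cons, List.nodup_append, List.mem_append, List.mem_cons,
      Set.mem_union] at *
    grind
  · simp only [List.getLast?_cons, List.getLast?_append] at hx ⊢
    grind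
  · simp only [List.nodup_cons, List.nodup_append, List.mem_append, List.mem_cons] at *
    grind
  · simp only [List.nodup_cons, List.nodup_append, List.mem_append, List.mem_cons,
      Set.mem_union] at *
    grind
  · simp only [List.nodup_cons, List.nodup_append, List.mem_append, List.mem_cons] at *
    grind
  · simp only [List.nodup_cons, List.nodup_append, List.mem_append, List.mem_cons,
      Set.mem_union] at *
    grind

lemma loop_injOn (h : Ring A AL AT AR L T R a b c) {o x : α} :
    Set.InjOn (loop b c a) (Pairs AL o b a x L ×ˢ Mids AT b c T ×ˢ Mids AR c a R) := by
  rintro ⟨⟨p, q⟩, m, r⟩ hz ⟨⟨p', q'⟩, m', r'⟩ - e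
  have hd := (h.loop_mem hz).2.1.of_cons
  dsimp only [loop] at *
  obtain ⟨e1, e2⟩ := split_unique hd e
  have hd2 := (List.nodup_append.1 hd).2.1.of_cons
  obtain ⟨e3, e4⟩ := split_unique hd2 e2
  have hd3 := (List.nodup_append.1 hd2).2.1.of_cons
  obtain ⟨e5, e6⟩ := split_unique hd3 e4
  simp [*]

lemma loop_of_via (h : Ring A AL AT AR L T R a b c) {o x : α} (ho : o ∈ L) (hx : x ∈ L)
    {r : α} (hr : r ∈ R) (hra : r ≠ a) (hrc : r ≠ c) {l : List α}
    (hl : l ∈ Tails A o x (L ∪ T ∪ R)) (hv : Via AL AT AR a b c o l) :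
    l ∈ loop b c a '' (Pairs AL o b a x L ×ˢ Mids AT b c T ×ˢ Mids AR c a R) := by
  have lt := h.left_top
  have lr := h.left_right
  have tr := h.top_right
  obtain ⟨p, l', rfl, h1, h2 | ⟨m, l', rfl, h2, h3 | ⟨s, q, rfl, h3, h4⟩⟩⟩ := hv
  · have m1 := mem_of_isChain h.left ho h1
    have m2 := mem_of_isChain h.top ((lt b).2 rfl).2 h2
    have := (hl.2.2.1 r).2 (.inr hr)
    grind
  · have m3 := mem_of_isChain h.right ((tr c).2 rfl).2 h3
    have hlast := hl.2.2.2
    have hxa : x = a := by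
      refine (lr x).1 ⟨hx, m3 x ?_⟩
      simp only [List.getLast?_cons, List.getLast?_append] at hlast
      rw [List.mem_cons]
      grind [List.mem_of_getLast?]
    subst hxa
    rcases List.eq_nil_or_concat l' with rfl | ⟨k, w, rfl⟩
    · simp only [List.getLast?_cons, List.getLast?_append] at hlast
      exact absurd (by simpa using hlast) h.ac.symm
    · have : w = x := by simpa [List.getLast?_cons, List.getLast?_append] using hlast
      subst this
      refine ⟨((p, []), m, k), h.mem_of_loop_mem ho ?_ h1 h2 (by simpa using h3) (by simp),
        by simp [loop]⟩
      simpa [loop] using hl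
  · exact ⟨((p, q), m, s), h.mem_of_loop_mem ho hl h1 h2 h3 h4, rfl⟩

lemma tails_eq_loop (h : Ring A AL AT AR L T R a b c) {o x : α} (ho : o ∈ L) (hoa : o ≠ a)
    (hob : o ≠ b) (hx : x ∈ L) {t r : α} (ht : t ∈ T) (htb : t ≠ b) (htc : t ≠ c)
    (hr : r ∈ R) (hra : r ≠ a) (hrc : r ≠ c) :
    Tails A o x (L ∪ T ∪ R) =
      loop b c a '' (Pairs AL o b a x L ×ˢ Mids AT b c T ×ˢ Mids AR c a R) ∪
      loop a c b '' (Pairs AL o a b x L ×ˢ Mids AR a c R ×ˢ Mids AT c b T) := by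
  have e : L ∪ R ∪ T = L ∪ T ∪ R := Set.union_right_comm ..
  ext l
  constructor
  · intro hl
    rcases h.via ho hob hoa hl.1 hl.2.1 with h' | h' | h'
    · have := mem_of_isChain h.left ho h' t ((hl.2.2.1 t).2 (by simp [ht]))
      exact absurd ((h.left_top t).1 ⟨this, ht⟩) htb
    · exact .inl (h.loop_of_via ho hx hr hra hrc hl h')
    · exact .inr (h.mirror.loop_of_via ho hx ht htb htc (by rwa [e]) h')
  · rintro (⟨z, hz, rfl⟩ | ⟨z, hz, rfl⟩)
    · exact h.loop_mem hz
    · rw [← e]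
      exact h.mirror.loop_mem hz

/-- The number of Hamiltonian paths from `o` to a vertex of `L`. -/
lemma ncard_tails_left (h : Ring A AL AT AR L T R a b c) (hL : L.Finite) (hT : T.Finite)
    (hR : R.Finite) {o x : α} (ho : o ∈ L) (hoa : o ≠ a)
    (hob : o ≠ b) (hx : x ∈ L) {t r : α} (ht : t ∈ T) (htb : t ≠ b) (htc : t ≠ c)
    (hr : r ∈ R) (hra : r ≠ a) (hrc : r ≠ c) :
    (Tails A o x (L ∪ T ∪ R)).ncard =
      (Pairs AL o b a x L).ncard * ((Mids AT b c T).ncard * (Mids AR c a R).ncard) +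
      (Pairs AL o a b x L).ncard * ((Mids AR a c R).ncard * (Mids AT c b T).ncard) := by
  rw [h.tails_eq_loop ho hoa hob hx ht htb htc hr hra hrc, Set.ncard_union_eq ?_
    (((finite_pairs hL).prod ((finite_mids hT).prod (finite_mids hR))).image _)
    (((finite_pairs hL).prod ((finite_mids hR).prod (finite_mids hT))).image _),
    h.loop_injOn.ncard_image, h.mirror.loop_injOn.ncard_image]
  · simp only [Set.ncard_prod]
  · rw [Set.disjoint_left]
    rintro _ ⟨z, hz, rfl⟩ ⟨z', hz', e⟩
    have hd := (h.loop_mem hz).2.1.of_cons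
    have hd' := (h.mirror.loop_mem hz').2.1.of_cons
    simp only [loop] at e hd hd'
    have e1 : (z'.1.1 ++ a :: z'.2.1) ++ c :: (z'.2.2 ++ b :: z'.1.2) =
      (z.1.1 ++ b :: z.2.1) ++ c :: (z.2.2 ++ a :: z.1.2) := by simpa using e
    have := (split_unique (by simpa using hd') e1).1
    grind

lemma last_mem {B : α → α → Prop} {X : Set α} (hB : ∀ x y, B x y → x ∈ X ∧ y ∈ X)
    {u x : α} {l : List α} (hu : u ∈ X) (h : (u :: l).IsChain B)
    (hx : (u :: l).getLast? = some x) : x ∈ X :=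
  mem_of_isChain hB hu h x (List.mem_of_getLast? hx)

/-- The two courses of a path from `o` to a vertex `x` of `T`. -/
lemma cross (h : Ring A AL AT AR L T R a b c) {o x : α} (ho : o ∈ L) (hoa : o ≠ a) (hob : o ≠ b)
    (hx : x ∈ T) (hxb : x ≠ b) (hxc : x ≠ c) {p : List α}
    (hl : (o :: (p ++ [x])).IsChain A) (hd : (o :: (p ++ [x])).Nodup) :
    (∃ p' m, p = p' ++ b :: m ∧ (o :: (p' ++ [b])).IsChain AL ∧ (b :: (m ++ [x])).IsChain AT) ∨
    (∃ p' r m, p = p' ++ a :: (r ++ c :: m) ∧ (o :: (p' ++ [a])).IsChain AL ∧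
      (a :: (r ++ [c])).IsChain AR ∧ (c :: (m ++ [x])).IsChain AT) := by
  have lt := h.left_top
  have lr := h.left_right
  have tr := h.top_right
  have key : ∀ {s : α} {k k' : List α}, s ≠ x → p ++ [x] = k ++ s :: k' →
      ∃ m, k' = m ++ [x] ∧ p = k ++ s :: m := by
    intro s k k' hs e
    rcases List.eq_nil_or_concat k' with rfl | ⟨m, w, rfl⟩
    · exact absurd (List.append_inj' e rfl).2 (by simpa using hs.symm)
    · rw [List.concat_eq_append] at *
      rw [← List.cons_append, ← List.append_assoc] at e
      obtain ⟨e1, e2⟩ := List.append_inj' e rfl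
      simp at e2
      exact ⟨m, by simp [e2], e1⟩
  have hlast : ∀ {s : α} {m : List α}, (s :: (m ++ [x])).getLast? = some x := by
    simp [List.getLast?_cons]
  have notL : x ∉ L := fun h' ↦ hxb ((lt x).1 ⟨h', hx⟩)
  have notR : x ∉ R := fun h' ↦ hxc ((tr x).1 ⟨hx, h'⟩)
  have hxa : x ≠ a := fun h' ↦ notL (h' ▸ ((lr a).2 rfl).1)
  rcases h.via ho hob hoa hl hd with h' | ⟨p', l', e, h1, h2 | ⟨m, l'', rfl, h2, h3⟩⟩ |
    ⟨p', l', e, h1, h2 | ⟨m, l'', rfl, h2, h3⟩⟩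
  · exact absurd (last_mem h.left ho h' hlast) notL
  · obtain ⟨m, rfl, rfl⟩ := key hxb.symm e
    exact .inl ⟨p', m, rfl, h1, h2⟩
  · rw [← List.cons_append, ← List.append_assoc] at e
    obtain ⟨k, rfl, -⟩ := key hxc.symm e
    rcases h3 with h3 | ⟨r, q, e', h3, h4⟩
    · exact absurd (last_mem h.right ((tr c).2 rfl).2 h3 hlast) notR
    · rw [e', ← List.cons_append, ← List.append_assoc] at e
      obtain ⟨k', rfl, -⟩ := key hxa.symm e
      exact absurd (last_mem h.left ((lr a).2 rfl).1 h4 hlast) notL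
  · obtain ⟨m, rfl, rfl⟩ := key hxa.symm e
    exact absurd (last_mem h.right ((lr a).2 rfl).2 h2 hlast) notR
  · have e0 := e
    rw [← List.cons_append, ← List.append_assoc] at e
    obtain ⟨k, rfl, rfl⟩ := key hxc.symm e
    rcases h3 with h3 | ⟨r, q, e', h3, h4⟩
    · exact .inr ⟨p', m, k, by simp, h1, h2, h3⟩
    · rw [e', ← List.cons_append, ← List.append_assoc] at e
      obtain ⟨k', rfl, -⟩ := key hxb.symm e
      exact absurd (last_mem h.left ((lt b).2 rfl).1 h4 hlast) notL

/-- The path that runs through `L`, `R` and `T`, in this order. -/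
def arc (a c : α) (z : List α × List α × List α) : List α :=
  z.1 ++ a :: (z.2.1 ++ c :: z.2.2)

lemma arc_mem (h : Ring A AL AT AR L T R a b c) {o x : α} {S L' T' : Set α} (hS : S ⊆ R)
    (hL' : L' ⊆ L) (hT' : T' ⊆ T) (hLT : L' ∪ T' = L ∪ T) (hb : b ∉ L' ∨ b ∉ T')
    {z : List α × List α × List α}
    (hz : z ∈ Mids AL o a L' ×ˢ Mids AR a c S ×ˢ Mids AT c x T') :
    arc a c z ∈ Mids A o x (L ∪ T ∪ S) := by
  obtain ⟨p, r, m⟩ := z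
  obtain ⟨⟨h1, h2, h3⟩, ⟨h4, h5, h6⟩, h7, h8, h9⟩ := hz
  rw [← hLT]
  dsimp only [arc] at *
  obtain ⟨gL, gT, gR⟩ := h.glue
  have lt := h.left_top
  have lr := h.left_right
  have tr := h.top_right
  refine ⟨?_, ?_, ?_⟩
  · simp only [List.append_assoc, List.cons_append]
    exact isChain_glue (h1.imp gL) (isChain_glue (h4.imp gR) (h7.imp gT))
  · simp only [List.nodup_cons, List.nodup_append, List.mem_append, List.mem_cons,
      Set.subset_def] at *
    grind
  · simp only [List.nodup_cons, List.nodup_append, List.mem_append, List.mem_cons, Set.mem_union,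
      Set.subset_def] at *
    grind

lemma mids_eq_arc (h : Ring A AL AT AR L T R a b c) {o x r : α} {S : Set α} (ho : o ∈ L)
    (hoa : o ≠ a) (hob : o ≠ b) (hx : x ∈ T) (hxb : x ≠ b) (hxc : x ≠ c) (hS : S ⊆ R)
    (haS : a ∈ S) (hcS : c ∈ S)
    (hr : r ∈ S) (hra : r ≠ a) (hrc : r ≠ c) :
    Mids A o x (L ∪ T ∪ S) =
      arc a c '' (Mids AL o a L ×ˢ Mids AR a c S ×ˢ Mids AT c x (T \ {b}) ∪
        Mids AL o a (L \ {b}) ×ˢ Mids AR a c S ×ˢ Mids AT c x T) := by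
  have lt := h.left_top
  have lr := h.left_right
  have tr := h.top_right
  have hbL := (lt b).2 rfl
  ext l
  constructor
  · rintro ⟨h1, h2, h3⟩
    rcases h.cross ho hoa hob hx hxb hxc h1 h2 with ⟨p, m, rfl, h4, h5⟩ | ⟨p, q, m, rfl, h4, h5, h6⟩
    · exfalso
      have m1 := mem_of_isChain h.left ho h4
      have m2 := mem_of_isChain h.top hbL.2 h5
      have := (h3 r).2 (.inr hr)
      have := hS hr
      simp only [List.mem_append, List.mem_cons] at *
      grind
    · refine ⟨(p, q, m), ?_, rfl⟩
      have m1 := mem_of_isChain h.left ho h4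
      have m2 := mem_of_isChain h.right ((lr a).2 rfl).2 h5
      have m3 := mem_of_isChain h.top ((tr c).2 rfl).1 h6
      have d1 : (o :: (p ++ [a])).Nodup := by
        simp only [List.nodup_cons, List.nodup_append, List.mem_append, List.mem_cons] at *
        grind
      have d2 : (a :: (q ++ [c])).Nodup := by
        simp only [List.nodup_cons, List.nodup_append, List.mem_append, List.mem_cons] at *
        grind
      have d3 : (c :: (m ++ [x])).Nodup := by
        simp only [List.nodup_cons, List.nodup_append, List.mem_append, List.mem_cons] at *
        grind
      have hq : ∀ y, y ∈ a :: (q ++ [c]) ↔ y ∈ S := by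
        simp only [List.nodup_cons, List.nodup_append, List.mem_append, List.mem_cons,
          Set.mem_union, Set.subset_def] at *
        grind
      by_cases hb : b ∈ p
      · left
        refine ⟨⟨h4, d1, ?_⟩, ⟨h5, d2, hq⟩, h6, d3, ?_⟩ <;>
        · simp only [List.nodup_cons, List.nodup_append, List.mem_append, List.mem_cons,
            Set.mem_union, Set.subset_def, Set.mem_sdiff, Set.mem_singleton_iff] at *
          grind
      · right
        have hab := h.ab
        refine ⟨⟨h4, d1, ?_⟩, ⟨h5, d2, hq⟩, h6, d3, ?_⟩ <;>
        · simp only [List.nodup_cons, List.nodup_append, List.mem_append, List.mem_cons,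
            Set.mem_union, Set.subset_def, Set.mem_sdiff, Set.mem_singleton_iff] at *
          grind
  · rintro ⟨z, hz | hz, rfl⟩
    · refine h.arc_mem hS subset_rfl Set.sdiff_subset ?_ (by simp) hz
      ext y
      simp only [Set.mem_union, Set.mem_sdiff, Set.mem_singleton_iff]
      grind
    · refine h.arc_mem hS Set.sdiff_subset subset_rfl ?_ (by simp) hz
      ext y
      simp only [Set.mem_union, Set.mem_sdiff, Set.mem_singleton_iff]
      grind

/-- The number of paths from `o` to a vertex `x` of `T` that visit all of `L`, `T` and a part
of `R` having a vertex other than the two junctions. -/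
lemma ncard_mids_arc (h : Ring A AL AT AR L T R a b c) (hL : L.Finite) (hT : T.Finite)
    (hR : R.Finite) {o x r : α} {S : Set α} (ho : o ∈ L)
    (hoa : o ≠ a) (hob : o ≠ b) (hx : x ∈ T) (hxb : x ≠ b) (hxc : x ≠ c) (hS : S ⊆ R)
    (haS : a ∈ S) (hcS : c ∈ S)
    (hr : r ∈ S) (hra : r ≠ a) (hrc : r ≠ c) :
    (Mids A o x (L ∪ T ∪ S)).ncard =
      (Mids AL o a L).ncard * ((Mids AR a c S).ncard * (Mids AT c x (T \ {b})).ncard) +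
      (Mids AL o a (L \ {b})).ncard * ((Mids AR a c S).ncard * (Mids AT c x T).ncard) := by
  have key := h.mids_eq_arc ho hoa hob hx hxb hxc hS haS hcS hr hra hrc
  have hbL := ((h.left_top b).2 rfl).1
  rw [key, Set.InjOn.ncard_image, Set.ncard_union_eq ?_
    ((finite_mids hL).prod ((finite_mids (hR.subset hS)).prod (finite_mids hT.sdiff)))
    ((finite_mids hL.sdiff).prod ((finite_mids (hR.subset hS)).prod (finite_mids hT)))]
  · simp only [Set.ncard_prod]
  · rw [Set.disjoint_left]
    rintro z ⟨hz, -, -⟩ ⟨hz', -, -⟩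
    exact ((hz'.2.2 b).1 ((hz.2.2 b).2 hbL)).2 rfl
  · rintro ⟨p, r, m⟩ hz ⟨p', r', m'⟩ - e
    have hm : arc a c (p, r, m) ∈ Mids A o x (L ∪ T ∪ S) := by
      rw [key]
      exact Set.mem_image_of_mem _ hz
    have hd := hm.2.1.of_cons
    dsimp only [arc] at e hd
    have hd1 := (List.nodup_append.1 hd).1
    obtain ⟨e1, e2⟩ := split_unique hd1 e
    obtain ⟨e3, e4⟩ := split_unique (List.nodup_append.1 hd1).2.1.of_cons e2
    simp [*]

lemma eq_append_singleton {u s : α} {q : List α} (hus : u ≠ s) (h : (u :: q).getLast? = some s) :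
    ∃ r, q = r ++ [s] := by
  rcases List.eq_nil_or_concat q with rfl | ⟨k, w, rfl⟩
  · exact absurd (by simpa using h) hus
  · rw [List.concat_eq_append] at *
    have : w = s := by simpa [List.getLast?_cons] using h
    exact ⟨k, by rw [this]⟩

/-- A path from `o` to `b'` together with a disjoint path from `a'` to a vertex of `L`. -/
def weave (b a : α) (z : (List α × List α) × List α × List α) : List α × List α :=
  (z.1.1 ++ b :: z.2.1, z.2.2 ++ a :: z.1.2)

lemma weave_mem (h : Ring A AL AT AR L T R a b c) {o x b' a' : α}
    {T' R' : Set α} (hT' : T' ⊆ T) (hR' : R' ⊆ R) (hTR : T' ∪ R' = T ∪ R) (hc : c ∉ T' ∨ c ∉ R')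
    {z : (List α × List α) × List α × List α}
    (hz : z ∈ Pairs AL o b a x L ×ˢ Mids AT b b' T' ×ˢ Mids AR a' a R') :
    weave b a z ∈ Pairs A o b' a' x (L ∪ T ∪ R) := by
  obtain ⟨⟨p, q⟩, m, r⟩ := z
  obtain ⟨⟨h1, h2, h3, h4, h5⟩, ⟨h6, h7, h8⟩, h9, h10, h11⟩ := hz
  rw [Set.union_assoc, ← hTR]
  dsimp only [weave] at *
  obtain ⟨gL, gT, gR⟩ := h.glue
  have lt := h.left_top
  have lr := h.left_right
  have tr := h.top_right
  refine ⟨?_, ?_, ?_, ?_, ?_⟩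
  · simp only [List.append_assoc, List.cons_append]
    exact isChain_glue (h1.imp gL) (h6.imp gT)
  · exact isChain_glue (h9.imp gR) (h2.imp gL)
  · simp only [List.nodup_cons, List.nodup_append, List.mem_append, List.mem_cons,
      Set.subset_def] at *
    grind
  · simp only [List.nodup_cons, List.nodup_append, List.mem_append, List.mem_cons, Set.mem_union,
      Set.subset_def] at *
    grind
  · simp only [List.getLast?_cons, List.getLast?_append] at h5 ⊢
    grind

lemma weave_of_mem (h : Ring A AL AT AR L T R a b c) {o x b' a' : α} (ho : o ∈ L) (hoa : o ≠ a)
    (hob : o ≠ b) (hb' : b' ∈ T) (hbb : b' ≠ b) (hbc : b' ≠ c) (ha' : a' ∈ R) (haa : a' ≠ a)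
    (hac : a' ≠ c) (hx : x ∈ L) {z : List α × List α}
    (hz : z ∈ Pairs A o b' a' x (L ∪ T ∪ R)) :
    ∃ p m q r, z = (p ++ b :: m, r ++ a :: q) ∧ (o :: (p ++ [b])).IsChain AL ∧
      (b :: (m ++ [b'])).IsChain AT ∧ (a' :: (r ++ [a])).IsChain AR ∧ (a :: q).IsChain AL := by
  have lt := h.left_top
  have lr := h.left_right
  have tr := h.top_right
  obtain ⟨k, l⟩ := z
  obtain ⟨h1, h2, h3, -, h5⟩ := hz
  dsimp only at *
  have d1 : (o :: (k ++ [b'])).Nodup := by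
    simp only [List.nodup_cons, List.nodup_append, List.mem_append, List.mem_cons] at *
    grind
  have d2 : (a' :: l).Nodup := by
    simp only [List.nodup_cons, List.nodup_append, List.mem_append, List.mem_cons] at *
    grind
  have dj : ∀ y ∈ o :: k, y ∉ a' :: l := by
    simp only [List.nodup_cons, List.nodup_append, List.mem_append, List.mem_cons] at *
    grind
  have hlx := List.mem_of_getLast? h5
  have hc := h.rotate.rotate.via ha' haa hac h2 d2
  rcases h.cross ho hoa hob hb' hbb hbc h1 d1 with
    ⟨p, m, rfl, h4, h6⟩ | ⟨p, r, m, rfl, h4, h6, h7⟩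
  · rcases hc with h8 | ⟨r, q, rfl, h8, h9 | ⟨m1, m2, rfl, -⟩⟩ |
      ⟨r, q, rfl, h8, h9 | ⟨m1, m2, rfl, -⟩⟩
    · obtain rfl := (lr x).1 ⟨hx, last_mem h.right ha' h8 h5⟩
      obtain ⟨r, rfl⟩ := eq_append_singleton haa h5
      exact ⟨p, m, [], r, rfl, h4, h6, h8, by simp⟩
    · exact ⟨p, m, q, r, rfl, h4, h6, h8, h9⟩
    · exact absurd (by simp) (dj b (by simp))
    · have : (c :: q).getLast? = some x := by
        simp only [List.getLast?_cons, List.getLast?_append] at h5 ⊢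
        grind
      obtain rfl := (lt x).1 ⟨hx, last_mem h.top ((tr c).2 rfl).1 h9 this⟩
      exact absurd hlx (dj x (by simp))
    · exact absurd (by simp) (dj b (by simp))
  · exfalso
    rcases hc with h8 | ⟨r, q, rfl, -⟩ | ⟨r, q, rfl, -⟩
    · obtain rfl := (lr x).1 ⟨hx, last_mem h.right ha' h8 h5⟩
      exact dj x (by simp) hlx
    · exact dj a (by simp) (by simp)
    · exact dj c (by simp) (by simp)

lemma pairs_eq_weave (h : Ring A AL AT AR L T R a b c) {o x b' a' : α} (ho : o ∈ L) (hoa : o ≠ a)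
    (hob : o ≠ b) (hb' : b' ∈ T) (hbb : b' ≠ b) (hbc : b' ≠ c) (ha' : a' ∈ R) (haa : a' ≠ a)
    (hac : a' ≠ c) (hx : x ∈ L) :
    Pairs A o b' a' x (L ∪ T ∪ R) =
      weave b a '' (Pairs AL o b a x L ×ˢ (Mids AT b b' T ×ˢ Mids AR a' a (R \ {c}) ∪
        Mids AT b b' (T \ {c}) ×ˢ Mids AR a' a R)) := by
  have lt := h.left_top
  have lr := h.left_right
  have tr := h.top_right
  ext z
  constructor
  · intro hz
    obtain ⟨p, m, q, r, rfl, h1, h2, h3, h4⟩ :=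
      h.weave_of_mem ho hoa hob hb' hbb hbc ha' haa hac hx hz
    refine ⟨((p, q), m, r), ?_, rfl⟩
    obtain ⟨-, -, h5, h6, h7⟩ := hz
    have m1 := mem_of_isChain h.left ho h1
    have m2 := mem_of_isChain h.top ((lt b).2 rfl).2 h2
    have m3 := mem_of_isChain h.right ha' h3
    have m4 := mem_of_isChain h.left ((lr a).2 rfl).1 h4
    have d1 : (b :: (m ++ [b'])).Nodup := by
      simp only [List.nodup_cons, List.nodup_append, List.mem_append, List.mem_cons] at *
      grind
    have d2 : (a' :: (r ++ [a])).Nodup := by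
      simp only [List.nodup_cons, List.nodup_append, List.mem_append, List.mem_cons] at *
      grind
    refine ⟨⟨h1, h4, ?_, ?_, ?_⟩, ?_⟩
    · simp only [List.nodup_cons, List.nodup_append, List.mem_append, List.mem_cons] at *
      grind
    · simp only [List.nodup_cons, List.nodup_append, List.mem_append, List.mem_cons,
        Set.mem_union] at *
      grind
    · simp only [List.getLast?_cons, List.getLast?_append] at h7 ⊢
      grind
    have hbc := h.bc
    have hac := h.ac
    by_cases hcm : c ∈ m
    · left
      refine ⟨⟨h2, d1, ?_⟩, h3, d2, ?_⟩ <;>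
      · simp only [List.nodup_cons, List.nodup_append, List.mem_append, List.mem_cons,
          Set.mem_union, Set.mem_sdiff, Set.mem_singleton_iff] at *
        grind
    · right
      refine ⟨⟨h2, d1, ?_⟩, h3, d2, ?_⟩ <;>
      · simp only [List.nodup_cons, List.nodup_append, List.mem_append, List.mem_cons,
          Set.mem_union, Set.mem_sdiff, Set.mem_singleton_iff] at *
        grind
  · rintro ⟨z, ⟨hz, hz' | hz'⟩, rfl⟩
    · refine h.weave_mem subset_rfl Set.sdiff_subset ?_ (by simp) ⟨hz, hz'⟩
      ext y
      simp only [Set.mem_union, Set.mem_sdiff, Set.mem_singleton_iff]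
      grind
    · refine h.weave_mem Set.sdiff_subset subset_rfl ?_ (by simp) ⟨hz, hz'⟩
      ext y
      simp only [Set.mem_union, Set.mem_sdiff, Set.mem_singleton_iff]
      grind

lemma ncard_pairs_left (h : Ring A AL AT AR L T R a b c) (hT : T.Finite)
    (hR : R.Finite) {o x b' a' : α} (ho : o ∈ L) (hoa : o ≠ a)
    (hob : o ≠ b) (hb' : b' ∈ T) (hbb : b' ≠ b) (hbc : b' ≠ c) (ha' : a' ∈ R) (haa : a' ≠ a)
    (hac : a' ≠ c) (hx : x ∈ L) :
    (Pairs A o b' a' x (L ∪ T ∪ R)).ncard =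
      (Pairs AL o b a x L).ncard * ((Mids AT b b' T).ncard * (Mids AR a' a (R \ {c})).ncard +
        (Mids AT b b' (T \ {c})).ncard * (Mids AR a' a R).ncard) := by
  have key := h.pairs_eq_weave ho hoa hob hb' hbb hbc ha' haa hac hx
  have hcT := ((h.top_right c).2 rfl).1
  rw [key, Set.InjOn.ncard_image, Set.ncard_prod, Set.ncard_union_eq ?_
    ((finite_mids hT).prod (finite_mids hR.sdiff))
    ((finite_mids hT.sdiff).prod (finite_mids hR))]
  · simp only [Set.ncard_prod]
  · rw [Set.disjoint_left]
    rintro z ⟨hz, -⟩ ⟨hz', -⟩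
    exact ((hz'.2.2 c).1 ((hz.2.2 c).2 hcT)).2 rfl
  · rintro ⟨⟨p, q⟩, m, r⟩ hz ⟨⟨p', q'⟩, m', r'⟩ - e
    have hm : weave b a ((p, q), m, r) ∈ Pairs A o b' a' x (L ∪ T ∪ R) := by
      rw [key]
      exact Set.mem_image_of_mem _ hz
    have hd := hm.2.2.1.of_cons
    simp only [weave, Prod.mk.injEq] at e hd
    obtain ⟨e1, e2⟩ := e
    rw [List.nodup_append] at hd
    obtain ⟨e3, e4⟩ := split_unique hd.1 e1
    obtain ⟨e5, e6⟩ := split_unique hd.2.1.of_cons.of_cons e2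
    simp [*]

/-- A path from `o` to `b'` together with a disjoint path from `a'` to `c`. -/
def braid (b : α) (z : List α × List α × List α) : List α × List α :=
  (z.1 ++ b :: z.2.1, z.2.2)

lemma braid_mem (h : Ring A AL AT AR L T R a b c) {o b' a' : α}
    {L' R' : Set α} (hL' : L' ⊆ L) (hR' : R' ⊆ R) (hLR : L' ∪ R' = L ∪ R) (ha : a ∉ L' ∨ a ∉ R')
    {z : List α × List α × List α}
    (hz : z ∈ Mids AL o b L' ×ˢ Mids AT b b' (T \ {c}) ×ˢ Tails AR a' c R') :
    braid b z ∈ Pairs A o b' a' c (L ∪ T ∪ R) := by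
  obtain ⟨p, m, r⟩ := z
  obtain ⟨⟨h1, h2, h3⟩, ⟨h6, h7, h8⟩, h9, h10, h11, h12⟩ := hz
  rw [Set.union_right_comm, ← hLR]
  dsimp only [braid] at *
  obtain ⟨gL, gT, gR⟩ := h.glue
  have lt := h.left_top
  have lr := h.left_right
  have tr := h.top_right
  have hcr := (h11 c).1 (List.mem_of_getLast? h12)
  refine ⟨?_, h9.imp gR, ?_, ?_, h12⟩
  · simp only [List.append_assoc, List.cons_append]
    exact isChain_glue (h1.imp gL) (h6.imp gT)
  · simp only [List.nodup_cons, List.nodup_append, List.mem_append, List.mem_cons,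
      Set.subset_def, Set.mem_sdiff, Set.mem_singleton_iff] at *
    grind
  · simp only [List.nodup_cons, List.nodup_append, List.mem_append, List.mem_cons, Set.mem_union,
      Set.subset_def, Set.mem_sdiff, Set.mem_singleton_iff] at *
    grind

lemma braid_of_mem (h : Ring A AL AT AR L T R a b c) {o b' a' : α} (ho : o ∈ L) (hoa : o ≠ a)
    (hob : o ≠ b) (hb' : b' ∈ T) (hbb : b' ≠ b) (hbc : b' ≠ c) (ha' : a' ∈ R) (haa : a' ≠ a)
    (hac : a' ≠ c) {z : List α × List α}
    (hz : z ∈ Pairs A o b' a' c (L ∪ T ∪ R)) :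
    ∃ p m q, z = (p ++ b :: m, q) ∧ (o :: (p ++ [b])).IsChain AL ∧
      (b :: (m ++ [b'])).IsChain AT ∧ (a' :: q).IsChain AR := by
  have lt := h.left_top
  have lr := h.left_right
  have tr := h.top_right
  have hcL : c ∉ L := fun h' ↦ h.bc ((lt c).1 ⟨h', ((tr c).2 rfl).1⟩).symm
  obtain ⟨k, l⟩ := z
  obtain ⟨h1, h2, h3, -, h5⟩ := hz
  dsimp only at *
  have d1 : (o :: (k ++ [b'])).Nodup := by
    simp only [List.nodup_cons, List.nodup_append, List.mem_append, List.mem_cons] at *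
    grind
  have d2 : (a' :: l).Nodup := by
    simp only [List.nodup_cons, List.nodup_append, List.mem_append, List.mem_cons] at *
    grind
  have dj : ∀ y ∈ o :: k, y ∉ a' :: l := by
    simp only [List.nodup_cons, List.nodup_append, List.mem_append, List.mem_cons] at *
    grind
  have hlx := List.mem_of_getLast? h5
  have hc := h.rotate.rotate.via ha' haa hac h2 d2
  rcases h.cross ho hoa hob hb' hbb hbc h1 d1 with
    ⟨p, m, rfl, h4, h6⟩ | ⟨p, r, m, rfl, h4, h6, h7⟩
  · refine ⟨p, m, l, rfl, h4, h6, ?_⟩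
    rcases hc with h8 | ⟨r, q, rfl, h8, h9 | ⟨m1, m2, rfl, -⟩⟩ | ⟨r, q, rfl, h8, -⟩
    · exact h8
    · have : (a :: q).getLast? = some c := by
        simp only [List.getLast?_cons, List.getLast?_append] at h5 ⊢
        grind
      exact absurd (last_mem h.left ((lr a).2 rfl).1 h9 this) hcL
    · exact absurd (by simp) (dj b (by simp))
    · obtain ⟨s, hs⟩ := eq_append_singleton hac h5
      have := (split_unique d2.of_cons hs).2
      rwa [this]
  · exact absurd hlx (dj c (by simp))

lemma pairs_eq_braid (h : Ring A AL AT AR L T R a b c) {o b' a' : α} (ho : o ∈ L) (hoa : o ≠ a)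
    (hob : o ≠ b) (hb' : b' ∈ T) (hbb : b' ≠ b) (hbc : b' ≠ c) (ha' : a' ∈ R) (haa : a' ≠ a)
    (hac : a' ≠ c) :
    Pairs A o b' a' c (L ∪ T ∪ R) =
      braid b '' (Mids AL o b (L \ {a}) ×ˢ Mids AT b b' (T \ {c}) ×ˢ Tails AR a' c R ∪
        Mids AL o b L ×ˢ Mids AT b b' (T \ {c}) ×ˢ Tails AR a' c (R \ {a})) := by
  have lt := h.left_top
  have lr := h.left_right
  have tr := h.top_right
  ext z
  constructor
  · intro hz
    obtain ⟨p, m, q, rfl, h1, h2, h3⟩ :=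
      h.braid_of_mem ho hoa hob hb' hbb hbc ha' haa hac hz
    refine ⟨(p, m, q), ?_, rfl⟩
    obtain ⟨-, -, h5, h6, h7⟩ := hz
    have m1 := mem_of_isChain h.left ho h1
    have m2 := mem_of_isChain h.top ((lt b).2 rfl).2 h2
    have m3 := mem_of_isChain h.right ha' h3
    have hcq := List.mem_of_getLast? h7
    have hbc := h.bc
    have hab := h.ab
    dsimp only at *
    have d0 : (o :: (p ++ [b])).Nodup := by
      simp only [List.nodup_cons, List.nodup_append, List.mem_append, List.mem_cons] at *
      grind
    have d1 : (b :: (m ++ [b'])).Nodup := by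
      simp only [List.nodup_cons, List.nodup_append, List.mem_append, List.mem_cons] at *
      grind
    have d2 : (a' :: q).Nodup := by
      simp only [List.nodup_cons, List.nodup_append, List.mem_append, List.mem_cons] at *
      grind
    have d3 : ∀ y, y ∈ b :: (m ++ [b']) ↔ y ∈ T \ {c} := by
      simp only [List.nodup_cons, List.nodup_append, List.mem_append, List.mem_cons,
          Set.mem_union, Set.mem_sdiff, Set.mem_singleton_iff] at *
      grind
    by_cases hap : a ∈ p
    · right
      refine ⟨⟨h1, d0, ?_⟩, ⟨h2, d1, d3⟩, h3, d2, ?_, h7⟩ <;>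
      · clear d3
        simp only [List.nodup_cons, List.nodup_append, List.mem_append, List.mem_cons,
          Set.mem_union, Set.mem_sdiff, Set.mem_singleton_iff] at *
        grind
    · left
      refine ⟨⟨h1, d0, ?_⟩, ⟨h2, d1, d3⟩, h3, d2, ?_, h7⟩ <;>
      · clear d3
        simp only [List.nodup_cons, List.nodup_append, List.mem_append, List.mem_cons,
          Set.mem_union, Set.mem_sdiff, Set.mem_singleton_iff] at *
        grind
  · rintro ⟨z, hz | hz, rfl⟩
    · refine h.braid_mem Set.sdiff_subset subset_rfl ?_ (by simp) hz
      ext y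
      simp only [Set.mem_union, Set.mem_sdiff, Set.mem_singleton_iff]
      grind
    · refine h.braid_mem subset_rfl Set.sdiff_subset ?_ (by simp) hz
      ext y
      simp only [Set.mem_union, Set.mem_sdiff, Set.mem_singleton_iff]
      grind

lemma ncard_pairs_junction (h : Ring A AL AT AR L T R a b c) (hL : L.Finite) (hT : T.Finite)
    (hR : R.Finite) {o b' a' : α} (ho : o ∈ L) (hoa : o ≠ a)
    (hob : o ≠ b) (hb' : b' ∈ T) (hbb : b' ≠ b) (hbc : b' ≠ c) (ha' : a' ∈ R) (haa : a' ≠ a)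
    (hac : a' ≠ c) :
    (Pairs A o b' a' c (L ∪ T ∪ R)).ncard =
      (Mids AL o b (L \ {a})).ncard * ((Mids AT b b' (T \ {c})).ncard * (Tails AR a' c R).ncard) +
      (Mids AL o b L).ncard *
        ((Mids AT b b' (T \ {c})).ncard * (Tails AR a' c (R \ {a})).ncard) := by
  have key := h.pairs_eq_braid ho hoa hob hb' hbb hbc ha' haa hac
  have haL := ((h.left_right a).2 rfl).1
  rw [key, Set.InjOn.ncard_image, Set.ncard_union_eq ?_
    ((finite_mids hL.sdiff).prod ((finite_mids hT.sdiff).prod (finite_tails hR)))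
    ((finite_mids hL).prod ((finite_mids hT.sdiff).prod (finite_tails hR.sdiff)))]
  · simp only [Set.ncard_prod]
  · rw [Set.disjoint_left]
    rintro z ⟨hz, -⟩ ⟨hz', -⟩
    exact ((hz.2.2 a).1 ((hz'.2.2 a).2 haL)).2 rfl
  · rintro ⟨p, m, r⟩ hz ⟨p', m', r'⟩ - e
    have hm : braid b (p, m, r) ∈ Pairs A o b' a' c (L ∪ T ∪ R) := by
      rw [key]
      exact Set.mem_image_of_mem _ hz
    have hd := hm.2.2.1.of_cons
    simp only [braid, Prod.mk.injEq] at e hd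
    obtain ⟨e1, e2⟩ := e
    rw [List.nodup_append] at hd
    obtain ⟨e3, e4⟩ := split_unique hd.1 e1
    simp [*]

/-- No path from `o` to the vertex opposite to `L` visits all of `L`, `T` and `R`. -/
lemma tails_opposite_eq_empty (h : Ring A AL AT AR L T R a b c) {o t r : α} (ho : o ∈ L)
    (hoa : o ≠ a) (hob : o ≠ b) (ht : t ∈ T) (htb : t ≠ b) (htc : t ≠ c)
    (hr : r ∈ R) (hra : r ≠ a) (hrc : r ≠ c) : Tails A o c (L ∪ T ∪ R) = ∅ := by
  have lt := h.left_top
  have lr := h.left_right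
  have tr := h.top_right
  have hcL : c ∉ L := fun h' ↦ h.bc ((lt c).1 ⟨h', ((tr c).2 rfl).1⟩).symm
  have hoc : o ≠ c := fun h' ↦ hcL (h' ▸ ho)
  rw [Set.eq_empty_iff_forall_notMem]
  rintro l ⟨h1, h2, h3, h4⟩
  obtain ⟨k, rfl⟩ := eq_append_singleton hoc h4
  have ht' := (h3 t).2 (.inl (.inr ht))
  have hr' := (h3 r).2 (.inr hr)
  have aux : ∀ {p q : List α} {s : α}, k ++ [c] = p ++ s :: q → ∀ {m l : List α}, q = m ++ c :: l →
      l = [] := by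
    intro p q s e m l e'
    rw [e', ← List.cons_append, ← List.append_assoc] at e
    exact (split_unique h2.of_cons e).2.symm
  rcases h.via ho hob hoa h1 h2 with h' | ⟨p, l', e, h5, h6 | ⟨m, l'', rfl, h6, -⟩⟩ |
    ⟨p, l', e, h5, h6 | ⟨m, l'', rfl, h6, -⟩⟩
  · exact hcL (last_mem h.left ho h' h4)
  · rw [e] at hr'
    have m1 := mem_of_isChain h.left ho h5
    have m2 := mem_of_isChain h.top ((lt b).2 rfl).2 h6
    grind
  · obtain rfl := aux e rfl
    rw [e] at hr'
    have m1 := mem_of_isChain h.left ho h5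
    have m2 := mem_of_isChain h.top ((lt b).2 rfl).2 h6
    grind
  · rw [e] at ht'
    have m1 := mem_of_isChain h.left ho h5
    have m2 := mem_of_isChain h.right ((lr a).2 rfl).2 h6
    grind
  · obtain rfl := aux e rfl
    rw [e] at ht'
    have m1 := mem_of_isChain h.left ho h5
    have m2 := mem_of_isChain h.right ((lr a).2 rfl).2 h6
    grind

end Ring
end Paths

section Transport

variable {α β : Type*}

lemma ncard_mids_map {φ : α → β} (hφ : φ.Injective) (B : β → β → Prop) (u v : α) (W : Set α) :
    (Mids B (φ u) (φ v) (φ '' W)).ncard = (Mids (fun x y ↦ B (φ x) (φ y)) u v W).ncard := by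
  have key : ∀ m : List α, m.map φ ∈ Mids B (φ u) (φ v) (φ '' W) ↔
      m ∈ Mids (fun x y ↦ B (φ x) (φ y)) u v W := by
    intro m
    have e : φ u :: (m.map φ ++ [φ v]) = (u :: (m ++ [v])).map φ := by simp
    have e' : (∀ y, y ∈ (u :: (m ++ [v])).map φ ↔ y ∈ φ '' W) ↔
        ∀ y, y ∈ u :: (m ++ [v]) ↔ y ∈ W := by
      refine ⟨fun h y ↦ ?_, fun h y ↦ ?_⟩
      · have := h (φ y)
        rwa [List.mem_map_of_injective hφ, hφ.mem_set_image] at this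
      · simp only [List.mem_map, Set.mem_image, h]
    simp only [Mids, Set.mem_ofPred_eq, e]
    rw [e', List.isChain_map, List.nodup_map_iff hφ]
  have : Mids B (φ u) (φ v) (φ '' W) =
      List.map φ '' Mids (fun x y ↦ B (φ x) (φ y)) u v W := by
    ext l
    constructor
    · intro hl
      have : l ∈ Set.range (List.map φ) := by
        rw [Set.range_list_map]
        intro y hy
        exact Set.image_subset_range _ _ ((hl.2.2 y).1 (by simp [hy]))
      obtain ⟨m, rfl⟩ := this
      exact ⟨m, (key m).1 hl, rfl⟩
    · rintro ⟨m, hm, rfl⟩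
      exact (key m).2 hm
  rw [this, Set.ncard_image_of_injective _ hφ.list_map]

lemma ncard_pairs_map {φ : α → β} (hφ : φ.Injective) (B : β → β → Prop) (u v w x : α)
    (W : Set α) : (Pairs B (φ u) (φ v) (φ w) (φ x) (φ '' W)).ncard =
      (Pairs (fun x y ↦ B (φ x) (φ y)) u v w x W).ncard := by
  have key : ∀ p q : List α, (p.map φ, q.map φ) ∈ Pairs B (φ u) (φ v) (φ w) (φ x) (φ '' W) ↔
      (p, q) ∈ Pairs (fun x y ↦ B (φ x) (φ y)) u v w x W := by
    intro p q
    have e : φ u :: (p.map φ ++ φ v :: φ w :: q.map φ) = (u :: (p ++ v :: w :: q)).map φ := by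
      simp
    have e1 : φ u :: (p.map φ ++ [φ v]) = (u :: (p ++ [v])).map φ := by simp
    have e2 : φ w :: q.map φ = (w :: q).map φ := by simp
    have e' : (∀ y, y ∈ (u :: (p ++ v :: w :: q)).map φ ↔ y ∈ φ '' W) ↔
        ∀ y, y ∈ u :: (p ++ v :: w :: q) ↔ y ∈ W := by
      refine ⟨fun h y ↦ ?_, fun h y ↦ ?_⟩
      · have := h (φ y)
        rwa [List.mem_map_of_injective hφ, hφ.mem_set_image] at this
      · simp only [List.mem_map, Set.mem_image, h]
    have e3 : ((w :: q).map φ).getLast? = some (φ x) ↔ (w :: q).getLast? = some x := by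
      rw [List.getLast?_map, Option.map_eq_some_iff]
      simp [hφ.eq_iff]
    simp only [Pairs, Set.mem_ofPred_eq, e]
    rw [e', e1, e2, e3, List.isChain_map, List.isChain_map, List.nodup_map_iff hφ]
  have : Pairs B (φ u) (φ v) (φ w) (φ x) (φ '' W) =
      Prod.map (List.map φ) (List.map φ) '' Pairs (fun x y ↦ B (φ x) (φ y)) u v w x W := by
    ext ⟨k, l⟩
    constructor
    · intro hl
      have hk : k ∈ Set.range (List.map φ) := by
        rw [Set.range_list_map]
        intro y hy
        exact Set.image_subset_range _ _ ((hl.2.2.2.1 y).1 (by simp [hy]))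
      have hl' : l ∈ Set.range (List.map φ) := by
        rw [Set.range_list_map]
        intro y hy
        exact Set.image_subset_range _ _ ((hl.2.2.2.1 y).1 (by simp [hy]))
      obtain ⟨p, rfl⟩ := hk
      obtain ⟨q, rfl⟩ := hl'
      exact ⟨(p, q), (key p q).1 hl, rfl⟩
    · rintro ⟨⟨p, q⟩, hm, e⟩
      rw [← e]
      exact (key p q).2 hm
  rw [this, Set.ncard_image_of_injective _ (hφ.list_map.prodMap hφ.list_map)]

lemma ncard_mids_reverse {A : α → α → Prop} (hA : ∀ x y, A x y → A y x) (u v : α) (W : Set α) :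
    (Mids A u v W).ncard = (Mids A v u W).ncard := by
  have key : ∀ u v : α, ∀ m ∈ Mids A u v W, m.reverse ∈ Mids A v u W := by
    rintro u v m ⟨h1, h2, h3⟩
    have e : v :: (m.reverse ++ [u]) = (u :: (m ++ [v])).reverse := by simp
    refine ⟨?_, ?_, ?_⟩
    · rw [e, List.isChain_reverse]
      exact h1.imp hA
    · rw [e, List.nodup_reverse]
      exact h2
    · simp only [e, List.mem_reverse]
      exact h3
  have : Mids A v u W = List.reverse '' Mids A u v W := by
    ext l
    exact ⟨fun hl ↦ ⟨_, key _ _ l hl, by simp⟩, by rintro ⟨m, hm, rfl⟩; exact key _ _ m hm⟩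
  rw [this, Set.ncard_image_of_injective _ List.reverse_injective]

end Transport

/-- The vertices of `SG n` in the coordinates with respect to the basis `a 0`, `b 0`. -/
def Site : ℕ → Set (ℤ × ℤ)
  | 0 => {x | 0 ≤ x.1 ∧ 0 ≤ x.2 ∧ x.1 + x.2 ≤ 1}
  | n + 1 => Site n ∪ (· - (0, 2 ^ n)) ⁻¹' Site n ∪ (· - (2 ^ n, 0)) ⁻¹' Site n

/-- Adjacency in `SG n` in the coordinates with respect to the basis `a 0`, `b 0`. -/
def Link : ℕ → ℤ × ℤ → ℤ × ℤ → Prop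
  | 0, x, y => x ≠ y ∧ x ∈ Site 0 ∧ y ∈ Site 0
  | n + 1, x, y => Link n x y ∨ Link n (x - (0, 2 ^ n)) (y - (0, 2 ^ n)) ∨
      Link n (x - (2 ^ n, 0)) (y - (2 ^ n, 0))

lemma site_zero {x : ℤ × ℤ} : x ∈ Site 0 ↔ 0 ≤ x.1 ∧ 0 ≤ x.2 ∧ x.1 + x.2 ≤ 1 := Iff.rfl

lemma site_succ {n : ℕ} {x : ℤ × ℤ} : x ∈ Site (n + 1) ↔
    x ∈ Site n ∨ x - (0, 2 ^ n) ∈ Site n ∨ x - (2 ^ n, 0) ∈ Site n :=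
  or_assoc

lemma site_bounds {n : ℕ} {x : ℤ × ℤ} (h : x ∈ Site n) :
    0 ≤ x.1 ∧ 0 ≤ x.2 ∧ x.1 + x.2 ≤ 2 ^ n := by
  induction n generalizing x with
  | zero => simpa [site_zero] using h
  | succ n ih =>
    have : (0 : ℤ) < 2 ^ n := by positivity
    rw [pow_succ]
    rcases site_succ.1 h with h | h | h
    · have := ih h
      omega
    all_goals
      have := ih h
      simp only [Prod.fst_sub, Prod.snd_sub] at this
      omega

lemma site_finite (n : ℕ) : (Site n).Finite := by
  refine (Set.finite_Icc ((0, 0) : ℤ × ℤ) (2 ^ n, 2 ^ n)).subset fun x hx ↦ ?_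
  have := site_bounds hx
  simp only [Set.mem_Icc, Prod.le_def]
  omega

lemma site_corner (n : ℕ) : ((0, 0) : ℤ × ℤ) ∈ Site n ∧ ((2 ^ n, 0) : ℤ × ℤ) ∈ Site n ∧
    ((0, 2 ^ n) : ℤ × ℤ) ∈ Site n := by
  induction n with
  | zero => simp [Site]
  | succ n ih =>
    simp only [site_succ, Prod.mk_sub_mk, pow_succ, mul_two, add_sub_cancel_right, sub_zero]
    tauto

lemma link_site {n : ℕ} {x y : ℤ × ℤ} (h : Link n x y) : x ∈ Site n ∧ y ∈ Site n := by
  induction n generalizing x y with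
  | zero => exact h.2
  | succ n ih =>
    simp only [site_succ]
    rcases h with h | h | h <;> have := ih h <;> tauto

lemma link_symm {n : ℕ} {x y : ℤ × ℤ} (h : Link n x y) : Link n y x := by
  induction n generalizing x y with
  | zero => exact ⟨h.1.symm, h.2.2, h.2.1⟩
  | succ n ih => exact h.imp ih (Or.imp ih ih)

lemma link_ne {n : ℕ} {x y : ℤ × ℤ} (h : Link n x y) : x ≠ y := by
  induction n generalizing x y with
  | zero => exact h.1
  | succ n ih =>
    rintro rfl
    rcases h with h | h | h <;> exact ih h rfl

lemma site_swap {n : ℕ} {x : ℤ × ℤ} : x.swap ∈ Site n ↔ x ∈ Site n := by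
  induction n generalizing x with
  | zero => simp only [site_zero, Prod.fst_swap, Prod.snd_swap]; omega
  | succ n ih =>
    have e1 : x.swap - (0, 2 ^ n) = (x - (2 ^ n, 0)).swap := rfl
    have e2 : x.swap - (2 ^ n, 0) = (x - (0, 2 ^ n)).swap := rfl
    rw [site_succ, site_succ, e1, e2, ih, ih, ih]
    tauto

lemma link_swap {n : ℕ} {x y : ℤ × ℤ} : Link n x.swap y.swap ↔ Link n x y := by
  induction n generalizing x y with
  | zero => simp only [Link, site_swap, ne_eq, Prod.swap_inj]
  | succ n ih =>
    have e1 : ∀ x : ℤ × ℤ, x.swap - (0, 2 ^ n) = (x - (2 ^ n, 0)).swap := fun _ ↦ rfl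
    have e2 : ∀ x : ℤ × ℤ, x.swap - (2 ^ n, 0) = (x - (0, 2 ^ n)).swap := fun _ ↦ rfl
    simp only [Link, e1, e2, ih]
    tauto

/-- The reflection of `SG n` that exchanges its two lower corners. -/
def flip (n : ℕ) (x : ℤ × ℤ) : ℤ × ℤ := (2 ^ n - x.1 - x.2, x.2)

lemma flip_injective (n : ℕ) : (flip n).Injective := by
  rintro ⟨i, j⟩ ⟨k, l⟩ h
  simp only [flip, Prod.mk.injEq] at h ⊢
  omega

lemma flip_succ (n : ℕ) (x : ℤ × ℤ) : flip (n + 1) x = flip n (x - (2 ^ n, 0)) ∧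
    flip (n + 1) x - (0, 2 ^ n) = flip n (x - (0, 2 ^ n)) ∧
    flip (n + 1) x - (2 ^ n, 0) = flip n x := by
  obtain ⟨i, j⟩ := x
  simp only [flip, Prod.mk_sub_mk, Prod.mk.injEq, pow_succ, and_true]
  omega

lemma site_flip {n : ℕ} {x : ℤ × ℤ} : flip n x ∈ Site n ↔ x ∈ Site n := by
  induction n generalizing x with
  | zero => simp only [site_zero, flip]; omega
  | succ n ih =>
    obtain ⟨e1, e2, e3⟩ := flip_succ n x
    rw [site_succ, site_succ, e2, e3, e1, ih, ih, ih]
    tauto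

lemma link_flip {n : ℕ} {x y : ℤ × ℤ} : Link n (flip n x) (flip n y) ↔ Link n x y := by
  induction n generalizing x y with
  | zero => simp only [Link, site_flip, ne_eq, (flip_injective 0).eq_iff]
  | succ n ih =>
    obtain ⟨e1, e2, e3⟩ := flip_succ n x
    obtain ⟨e4, e5, e6⟩ := flip_succ n y
    simp only [Link, e2, e3, e5, e6]
    simp only [e1, e4, ih]
    tauto

lemma ring_link (n : ℕ) : Ring (Link (n + 1)) (Link n)
    (fun x y ↦ Link n (x - (0, 2 ^ n)) (y - (0, 2 ^ n)))
    (fun x y ↦ Link n (x - (2 ^ n, 0)) (y - (2 ^ n, 0)))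
    (Site n) ((· - (0, 2 ^ n)) ⁻¹' Site n) ((· - (2 ^ n, 0)) ⁻¹' Site n)
    (2 ^ n, 0) (0, 2 ^ n) (2 ^ n, 2 ^ n) := by
  have hN : (0 : ℤ) < 2 ^ n := by positivity
  obtain ⟨h1, h2, h3⟩ := site_corner n
  refine ⟨fun _ _ ↦ Iff.rfl, fun _ _ ↦ link_site, fun _ _ ↦ link_site, fun _ _ ↦ link_site,
    fun x ↦ ⟨?_, ?_⟩, fun x ↦ ⟨?_, ?_⟩, fun x ↦ ⟨?_, ?_⟩, ?_, ?_, ?_⟩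
  · rintro ⟨h, h'⟩
    have := site_bounds h
    have := site_bounds h'
    simp only [Prod.fst_sub, Prod.snd_sub, Prod.ext_iff] at *
    omega
  · rintro rfl
    refine ⟨h3, ?_⟩
    rw [Set.mem_preimage, sub_self]
    exact h1
  · rintro ⟨h, h'⟩
    have := site_bounds h
    have := site_bounds h'
    simp only [Prod.fst_sub, Prod.snd_sub, Prod.ext_iff] at *
    omega
  · rintro rfl
    refine ⟨h2, ?_⟩
    rw [Set.mem_preimage, sub_self]
    exact h1
  · rintro ⟨h, h'⟩
    have := site_bounds h
    have := site_bounds h'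
    simp only [Prod.fst_sub, Prod.snd_sub, Prod.ext_iff] at *
    omega
  · rintro rfl
    simpa [h2] using h3
  all_goals
    simp only [ne_eq, Prod.ext_iff]
    omega

/-- The number of Hamiltonian paths between two corners of `SG n`. -/
def full (n : ℕ) : ℕ := (Mids (Link n) (0, 0) (2 ^ n, 0) (Site n)).ncard

/-- The number of paths between two corners of `SG n` missing exactly the third corner. -/
def miss (n : ℕ) : ℕ := (Mids (Link n) (0, 0) (2 ^ n, 0) (Site n \ {(0, 2 ^ n)})).ncard

/-- The number of pairs of disjoint paths covering `SG n`, from `o` to the upper corner and from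
the right corner to `x`. -/
def pairs (n : ℕ) (x : ℤ × ℤ) : ℕ :=
  (Pairs (Link n) (0, 0) (0, 2 ^ n) (2 ^ n, 0) x (Site n)).ncard

lemma image_site {n : ℕ} {σ : ℤ × ℤ → ℤ × ℤ} (hσ : ∀ x, σ x ∈ Site n ↔ x ∈ Site n)
    (hi : ∀ x, σ (σ x) = x) : σ '' Site n = Site n := by
  ext x
  refine ⟨?_, fun h ↦ ⟨σ x, (hσ x).2 h, hi x⟩⟩
  rintro ⟨y, hy, rfl⟩
  exact (hσ y).2 hy

lemma flip_flip (n : ℕ) (x : ℤ × ℤ) : flip n (flip n x) = x := by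
  obtain ⟨i, j⟩ := x
  simp only [flip, Prod.mk.injEq, and_true]
  omega

lemma mids_swap (n : ℕ) (u v : ℤ × ℤ) (W : Set (ℤ × ℤ)) :
    (Mids (Link n) u.swap v.swap (Prod.swap '' W)).ncard = (Mids (Link n) u v W).ncard := by
  rw [ncard_mids_map Prod.swap_injective]
  simp only [link_swap]

lemma mids_flip (n : ℕ) (u v : ℤ × ℤ) (W : Set (ℤ × ℤ)) :
    (Mids (Link n) (flip n u) (flip n v) (flip n '' W)).ncard = (Mids (Link n) u v W).ncard := by
  rw [ncard_mids_map (flip_injective n)]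
  simp only [link_flip]

lemma mids_reverse (n : ℕ) (u v : ℤ × ℤ) (W : Set (ℤ × ℤ)) :
    (Mids (Link n) u v W).ncard = (Mids (Link n) v u W).ncard :=
  ncard_mids_reverse (fun _ _ ↦ link_symm) u v W

lemma image_swap_site (n : ℕ) : Prod.swap '' Site n = Site n :=
  image_site (fun _ ↦ site_swap) Prod.swap_swap

lemma image_flip_site (n : ℕ) : flip n '' Site n = Site n :=
  image_site (fun _ ↦ site_flip) (flip_flip n)

lemma full_corners (n : ℕ) :
    (Mids (Link n) (0, 0) (2 ^ n, 0) (Site n)).ncard = full n ∧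
    (Mids (Link n) (0, 0) (0, 2 ^ n) (Site n)).ncard = full n ∧
    (Mids (Link n) (2 ^ n, 0) (0, 2 ^ n) (Site n)).ncard = full n ∧
    (Mids (Link n) (2 ^ n, 0) (0, 0) (Site n)).ncard = full n ∧
    (Mids (Link n) (0, 2 ^ n) (0, 0) (Site n)).ncard = full n ∧
    (Mids (Link n) (0, 2 ^ n) (2 ^ n, 0) (Site n)).ncard = full n := by
  have h1 := mids_swap n (0, 0) (2 ^ n, 0) (Site n)
  have h2 := mids_flip n (0, 0) (0, 2 ^ n) (Site n)
  simp only [image_swap_site, image_flip_site, flip, Prod.swap_prod_mk, sub_zero, sub_self] at h1 h2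
  rw [mids_reverse n (2 ^ n, 0) (0, 0), mids_reverse n (0, 2 ^ n) (0, 0),
    mids_reverse n (0, 2 ^ n) (2 ^ n, 0), h2, h1]
  simp [full]

lemma miss_corners (n : ℕ) :
    (Mids (Link n) (0, 0) (2 ^ n, 0) (Site n \ {(0, 2 ^ n)})).ncard = miss n ∧
    (Mids (Link n) (0, 0) (0, 2 ^ n) (Site n \ {(2 ^ n, 0)})).ncard = miss n ∧
    (Mids (Link n) (2 ^ n, 0) (0, 2 ^ n) (Site n \ {(0, 0)})).ncard = miss n ∧
    (Mids (Link n) (2 ^ n, 0) (0, 0) (Site n \ {(0, 2 ^ n)})).ncard = miss n ∧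
    (Mids (Link n) (0, 2 ^ n) (0, 0) (Site n \ {(2 ^ n, 0)})).ncard = miss n ∧
    (Mids (Link n) (0, 2 ^ n) (2 ^ n, 0) (Site n \ {(0, 0)})).ncard = miss n := by
  have h1 := mids_swap n (0, 0) (2 ^ n, 0) (Site n \ {(0, 2 ^ n)})
  have h2 := mids_flip n (0, 0) (0, 2 ^ n) (Site n \ {(2 ^ n, 0)})
  simp only [Set.image_sdiff Prod.swap_injective, Set.image_sdiff (flip_injective n),
    Set.image_singleton,
    image_swap_site, image_flip_site, flip, Prod.swap_prod_mk, sub_zero, sub_self] at h1 h2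
  rw [mids_reverse n (2 ^ n, 0) (0, 0), mids_reverse n (0, 2 ^ n) (0, 0),
    mids_reverse n (0, 2 ^ n) (2 ^ n, 0), h2, h1]
  simp [miss]

lemma mids_sub (n : ℕ) (t u v : ℤ × ℤ) (W : Set (ℤ × ℤ)) :
    (Mids (fun x y ↦ Link n (x - t) (y - t)) u v ((· - t) ⁻¹' W)).ncard =
      (Mids (Link n) (u - t) (v - t) W).ncard := by
  rw [← ncard_mids_map (sub_left_injective (b := t)) (Link n),
    Set.image_preimage_eq _ fun x ↦ ⟨x + t, by simp⟩]

lemma mids_sub_sdiff (n : ℕ) (t u v w : ℤ × ℤ) :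
    (Mids (fun x y ↦ Link n (x - t) (y - t)) u v ((· - t) ⁻¹' Site n \ {w})).ncard =
      (Mids (Link n) (u - t) (v - t) (Site n \ {w - t})).ncard := by
  rw [← mids_sub]
  congr 2
  ext x
  simp

lemma site_outer (n : ℕ) : (((2 : ℤ) ^ (n + 1), (0 : ℤ)) - (2 ^ n, 0) ∈ Site n) ∧
    (((0 : ℤ), (2 : ℤ) ^ (n + 1)) - (0, 2 ^ n) ∈ Site n) := by
  simp only [Prod.mk_sub_mk, pow_succ, mul_two, add_sub_cancel_right, sub_zero]
  exact (site_corner n).2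

lemma full_succ (n : ℕ) : full (n + 1) = 2 * full n ^ 2 * miss n := by
  have hN : (0 : ℤ) < 2 ^ n := by positivity
  have e := (ring_link n).ncard_mids_arc (site_finite n)
    ((site_finite n).preimage (sub_left_injective.injOn))
    ((site_finite n).preimage (sub_left_injective.injOn)) (o := (0, 0)) (x := (0, 2 ^ (n + 1)))
    (r := (2 ^ (n + 1), 0)) (site_corner n).1 (by simp [hN.ne]) (by simp [hN.ne])
    (site_outer n).2 (by simp [pow_succ]) (by simp [hN.ne]) subset_rfl
    (((ring_link n).left_right _).2 rfl).2 (((ring_link n).top_right _).2 rfl).2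
    (site_outer n).1 (by simp [pow_succ]) (by simp [hN.ne])
  have h1 := full_corners n
  have h2 := miss_corners n
  change (Mids _ _ _ (Site (n + 1))).ncard = _ at e
  rw [(full_corners (n + 1)).2.1] at e
  simp only [Prod.mk_zero_zero] at h1 h2
  simp only [mids_sub, mids_sub_sdiff, Prod.mk_sub_mk, sub_self, sub_zero, Prod.mk_zero_zero, h1,
    h2, pow_succ (2 : ℤ) n, mul_two, add_sub_cancel_right] at e
  rw [e]
  ring

lemma miss_add_two (n : ℕ) : miss (n + 2) = 2 * full (n + 1) * miss (n + 1) ^ 2 := by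
  have hM : (0 : ℤ) < 2 ^ (n + 1) := by positivity
  have hN : (0 : ℤ) < 2 ^ n := by positivity
  have e := (ring_link (n + 1)).ncard_mids_arc (site_finite (n + 1))
    ((site_finite (n + 1)).preimage (sub_left_injective.injOn))
    ((site_finite (n + 1)).preimage (sub_left_injective.injOn)) (o := (0, 0))
    (x := (0, 2 ^ (n + 2)))
    (r := (2 ^ (n + 1) + 2 ^ n, 0))
    (S := (· - (2 ^ (n + 1), 0)) ⁻¹' Site (n + 1) \ {(2 ^ (n + 2), 0)})
    (site_corner (n + 1)).1 (by simp [hM.ne]) (by simp [hM.ne])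
    (site_outer (n + 1)).2 (by simp [pow_succ]) (by simp) Set.sdiff_subset
    ⟨(((ring_link (n + 1)).left_right _).2 rfl).2, by simp [pow_succ]⟩
    ⟨(((ring_link (n + 1)).top_right _).2 rfl).2, by simp⟩
    ⟨by
      rw [Set.mem_preimage, Prod.mk_sub_mk, add_sub_cancel_left, sub_zero]
      exact .inl (.inl (site_corner n).2.1), by simp [pow_succ]; omega⟩ (by simp) (by simp)
  have h1 := full_corners (n + 1)
  have h2 := miss_corners (n + 1)
  have h3 := (miss_corners (n + 2)).2.1
  have e2 : Site (n + 1) ∪ (· - (0, 2 ^ (n + 1))) ⁻¹' Site (n + 1) ∪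
      ((· - (2 ^ (n + 1), 0)) ⁻¹' Site (n + 1) \ {(2 ^ (n + 2), 0)}) =
      Site (n + 2) \ {(2 ^ (n + 2), 0)} := by
    ext x
    have key : x ∈ Site (n + 1) ∨ x - (0, 2 ^ (n + 1)) ∈ Site (n + 1) →
        x ≠ (2 ^ (n + 2), 0) := by
      rintro (h | h) rfl <;>
      · have := site_bounds h
        simp only [Prod.mk_sub_mk, pow_succ] at this
        omega
    simp only [Set.mem_union, Set.mem_preimage, Set.mem_sdiff, Set.mem_singleton_iff,
      site_succ (n := n + 1)]
    tauto
  rw [e2, h3] at e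
  simp only [Prod.mk_zero_zero] at h1 h2
  simp only [mids_sub, mids_sub_sdiff, Prod.mk_sub_mk, sub_self, sub_zero, Prod.mk_zero_zero, h1,
    h2, pow_succ (2 : ℤ) (n + 1), mul_two, add_sub_cancel_right] at e
  rw [e]
  ring

lemma mids_eq_perm {α : Type*} {A : α → α → Prop} {u v : α} {W : Set α} {l : List α}
    (hd : (u :: (l ++ [v])).Nodup) (hW : ∀ y, y ∈ u :: (l ++ [v]) ↔ y ∈ W) :
    Mids A u v W = {m | m ∈ l.permutations' ∧ (u :: (m ++ [v])).IsChain A} := by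
  ext m
  simp only [Mids, Set.mem_ofPred_eq, List.mem_permutations']
  constructor
  · rintro ⟨h1, h2, h3⟩
    have : (u :: (m ++ [v])).Perm (u :: (l ++ [v])) :=
      (List.perm_ext_iff_of_nodup h2 hd).2 fun y ↦ (h3 y).trans (hW y).symm
    exact ⟨(List.perm_append_right_iff _).1 ((List.perm_cons _).1 this), h1⟩
  · rintro ⟨h1, h2⟩
    have : (u :: (m ++ [v])).Perm (u :: (l ++ [v])) :=
      (List.perm_cons _).2 ((List.perm_append_right_iff _).2 h1)
    exact ⟨h2, this.nodup_iff.2 hd, fun y ↦ this.mem_iff.trans (hW y)⟩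

lemma full_zero : full 0 = 1 := by
  rw [full, mids_eq_perm (l := [(0, 1)]) (by simp)]
  · rw [Set.ncard_eq_one]
    refine ⟨[(0, 1)], ?_⟩
    ext m
    simp only [List.permutations', Set.mem_ofPred_eq,
      Set.mem_singleton_iff]
    constructor
    · rintro ⟨h, -⟩
      simpa using h
    · rintro rfl
      simp [Link, Site]
  · rintro ⟨i, j⟩
    simp only [List.mem_cons, List.mem_append, List.not_mem_nil, site_zero, Prod.mk.injEq,
      pow_zero, or_false]
    omega

lemma miss_zero : miss 0 = 1 := by
  rw [miss, mids_eq_perm (l := []) (by simp)]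
  · rw [Set.ncard_eq_one]
    refine ⟨[], ?_⟩
    ext m
    simp only [List.permutations', Set.mem_ofPred_eq, Set.mem_singleton_iff]
    constructor
    · rintro ⟨h, -⟩
      simpa using h
    · rintro rfl
      simp [Link, Site]
  · rintro ⟨i, j⟩
    simp only [List.mem_cons, List.mem_append, List.not_mem_nil, site_zero, Prod.mk.injEq,
      pow_zero, or_false, Set.mem_sdiff, Set.mem_singleton_iff, false_or]
    omega

lemma full_one : full 1 = 2 := by
  rw [full_succ, full_zero, miss_zero]
  norm_num

lemma miss_one : miss 1 = 3 := by
  rw [miss, mids_eq_perm (l := [(1, 0), (0, 1), (1, 1)]) (by simp)]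
  · have : {m | m ∈ [((1 : ℤ), (0 : ℤ)), (0, 1), (1, 1)].permutations' ∧
        ((0, 0) :: (m ++ [(2 ^ 1, 0)])).IsChain (Link 1)} =
        {[(1, 0), (0, 1), (1, 1)], [(0, 1), (1, 0), (1, 1)], [(0, 1), (1, 1), (1, 0)]} := by
      ext m
      simp only [List.permutations', Set.mem_ofPred_eq,
        Set.mem_singleton_iff, Set.mem_insert_iff]
      constructor
      · rintro ⟨h, h'⟩
        simp at h
        rcases h with rfl | rfl | rfl | rfl | rfl | rfl <;> simp [Link, Site] at h' ⊢
      · rintro (rfl | rfl | rfl) <;> simp [Link, Site]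
    rw [this, Set.ncard_eq_toFinset_card']
    rfl
  · rintro ⟨i, j⟩
    simp only [List.mem_cons, List.mem_append, List.not_mem_nil, site_zero, site_succ (n := 0),
      Prod.mk.injEq, Prod.mk_sub_mk, pow_zero, pow_one, or_false, Set.mem_sdiff,
      Set.mem_singleton_iff]
    omega

lemma full_pos_and_miss_pos (n : ℕ) : 0 < full n ∧ 0 < miss n := by
  induction n with
  | zero => simp [full_zero, miss_zero]
  | succ n ih =>
    obtain ⟨h1, h2⟩ := ih
    cases n with
    | zero => simp [full_one, miss_one]
    | succ n =>
      rw [full_succ, miss_add_two]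
      constructor <;> positivity

lemma two_mul_miss_succ (n : ℕ) : 2 * miss (n + 1) = 3 * full (n + 1) := by
  induction n with
  | zero => simp [full_one, miss_one]
  | succ n ih =>
    rw [miss_add_two, full_succ (n + 1)]
    linear_combination (2 * full (n + 1) * miss (n + 1)) * ih

lemma pairs_swap (n : ℕ) (x : ℤ × ℤ) :
    (Pairs (Link n) (0, 0) (2 ^ n, 0) (0, 2 ^ n) x (Site n)).ncard = pairs n x.swap := by
  have := ncard_pairs_map Prod.swap_injective (Link n) (0, 0) (2 ^ n, 0) (0, 2 ^ n) x (Site n)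
  simp only [image_swap_site, link_swap] at this
  exact this.symm

lemma pairs_right (n : ℕ) : pairs n (2 ^ n, 0) = miss n := by
  have hN : (2 : ℤ) ^ n ≠ 0 := by positivity
  have h2 := (miss_corners n).2.1
  have hA := (site_corner n).2.1
  obtain ⟨w, hw⟩ : ∃ w : ℤ × ℤ, w = (2 ^ n, 0) := ⟨_, rfl⟩
  have hw0 : w ≠ (0, 0) := by simp [hw, hN]
  have hwv : w ≠ (0, 2 ^ n) := by simp [hw, hN]
  rw [← hw] at h2 hA
  suffices h : Pairs (Link n) (0, 0) (0, 2 ^ n) w w (Site n) =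
      (·, []) '' Mids (Link n) (0, 0) (0, 2 ^ n) (Site n \ {w}) by
    rw [pairs, ← hw, ← h2, h, Set.ncard_image_of_injective _ (Prod.mk_left_injective _)]
  ext ⟨p, q⟩
  constructor
  · rintro ⟨h1, -, h3, h4, h5⟩
    dsimp only at *
    obtain rfl : q = [] := by
      rcases List.eq_nil_or_concat q with h | ⟨k, y, rfl⟩
      · exact h
      · rw [List.concat_eq_append] at *
        have : y = w := by simpa [List.getLast?_cons] using h5
        simp only [List.nodup_cons, List.nodup_append, List.mem_append, List.mem_cons] at h3
        grind
    refine ⟨p, ⟨h1, ?_, ?_⟩, rfl⟩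
    · simp only [List.nodup_cons, List.nodup_append, List.mem_append, List.mem_cons] at *
      grind
    · simp only [List.nodup_cons, List.nodup_append, List.mem_append, List.mem_cons, Set.mem_sdiff,
        Set.mem_singleton_iff] at *
      grind
  · rintro ⟨m, ⟨h1, h2, h3⟩, e⟩
    obtain ⟨rfl, rfl⟩ := Prod.mk.inj e
    refine ⟨h1, by simp, ?_, ?_, by simp⟩
    · simp only [List.nodup_cons, List.nodup_append, List.mem_append, List.mem_cons, Set.mem_sdiff,
        Set.mem_singleton_iff] at *
      grind
    · simp only [List.nodup_cons, List.nodup_append, List.mem_append, List.mem_cons, Set.mem_sdiff,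
        Set.mem_singleton_iff] at *
      grind

lemma pairs_top (n : ℕ) : pairs n (0, 2 ^ n) = 0 := by
  have hN : (2 : ℤ) ^ n ≠ 0 := by positivity
  rw [pairs, Set.ncard_eq_zero (finite_pairs (site_finite n)), Set.eq_empty_iff_forall_notMem]
  rintro ⟨p, q⟩ ⟨-, -, h3, -, h5⟩
  have := List.mem_of_getLast? h5
  simp only [List.nodup_cons, List.nodup_append, List.mem_append, List.mem_cons, Prod.ext_iff] at *
  grind

lemma pairs_succ {n : ℕ} {x : ℤ × ℤ} (hx : x ∈ Site n) :
    pairs (n + 1) x = pairs n x * (2 * full n * miss n) := by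
  have hN : (0 : ℤ) < 2 ^ n := by positivity
  have e := (ring_link n).ncard_pairs_left
    ((site_finite n).preimage (sub_left_injective.injOn))
    ((site_finite n).preimage (sub_left_injective.injOn)) (o := (0, 0)) (b' := (0, 2 ^ (n + 1)))
    (a' := (2 ^ (n + 1), 0)) (site_corner n).1 (by simp [hN.ne]) (by simp [hN.ne])
    (site_outer n).2 (by simp [pow_succ]) (by simp [hN.ne])
    (site_outer n).1 (by simp [pow_succ]) (by simp [hN.ne]) hx
  have h1 := full_corners n
  have h2 := miss_corners n
  change pairs (n + 1) x = pairs n x * _ at e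
  simp only [Prod.mk_zero_zero] at h1 h2
  simp only [mids_sub, mids_sub_sdiff, Prod.mk_sub_mk, sub_self, sub_zero, h1, h2,
    pow_succ (2 : ℤ) n, mul_two, add_sub_cancel_right] at e
  rw [e]
  ring

lemma pairs_succ_junction (n : ℕ) :
    pairs (n + 1) (2 ^ n, 2 ^ n) = 2 * full n * miss n ^ 2 := by
  have hN : (0 : ℤ) < 2 ^ n := by positivity
  have e := (ring_link n).ncard_pairs_junction (site_finite n)
    ((site_finite n).preimage (sub_left_injective.injOn))
    ((site_finite n).preimage (sub_left_injective.injOn)) (o := (0, 0)) (b' := (0, 2 ^ (n + 1)))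
    (a' := (2 ^ (n + 1), 0)) (site_corner n).1 (by simp [hN.ne]) (by simp [hN.ne])
    (site_outer n).2 (by simp [pow_succ]) (by simp [hN.ne])
    (site_outer n).1 (by simp [pow_succ]) (by simp [hN.ne])
  have h1 := full_corners n
  have h2 := miss_corners n
  change pairs (n + 1) _ = _ at e
  rw [← ncard_mids (by simp), ← ncard_mids (by simp)] at e
  simp only [Prod.mk_zero_zero] at h1 h2
  simp only [mids_sub, mids_sub_sdiff, Prod.mk_sub_mk, sub_self, sub_zero, Prod.mk_zero_zero, h1,
    h2, pow_succ (2 : ℤ) n, mul_two, add_sub_cancel_right] at e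
  rw [e]
  ring

/-- The number of Hamiltonian paths of `SG n` from `o` to `x`. -/
def paths (n : ℕ) (x : ℤ × ℤ) : ℕ := (Tails (Link n) (0, 0) x (Site n)).ncard

lemma paths_succ {n : ℕ} {x : ℤ × ℤ} (hx : x ∈ Site n) :
    paths (n + 1) x = full n ^ 2 * (pairs n x + pairs n x.swap) := by
  have hN : (0 : ℤ) < 2 ^ n := by positivity
  have e := (ring_link n).ncard_tails_left (site_finite n)
    ((site_finite n).preimage (sub_left_injective.injOn))
    ((site_finite n).preimage (sub_left_injective.injOn)) (o := (0, 0)) (t := (0, 2 ^ (n + 1)))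
    (r := (2 ^ (n + 1), 0)) (site_corner n).1 (by simp [hN.ne]) (by simp [hN.ne]) hx
    (site_outer n).2 (by simp [pow_succ]) (by simp [hN.ne])
    (site_outer n).1 (by simp [pow_succ]) (by simp [hN.ne])
  have h1 := full_corners n
  change paths (n + 1) x = pairs n x * _ + _ at e
  rw [pairs_swap] at e
  simp only [Prod.mk_zero_zero] at h1
  simp only [mids_sub, Prod.mk_sub_mk, sub_self, sub_zero, h1] at e
  rw [e]
  ring

lemma paths_succ_junction (n : ℕ) : paths (n + 1) (2 ^ n, 2 ^ n) = 0 := by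
  have hN : (0 : ℤ) < 2 ^ n := by positivity
  have e := (ring_link n).tails_opposite_eq_empty (o := (0, 0)) (t := (0, 2 ^ (n + 1)))
    (r := (2 ^ (n + 1), 0)) (site_corner n).1 (by simp [hN.ne]) (by simp [hN.ne])
    (site_outer n).2 (by simp [pow_succ]) (by simp [hN.ne])
    (site_outer n).1 (by simp [pow_succ]) (by simp [hN.ne])
  change Tails _ _ _ (Site (n + 1)) = _ at e
  rw [paths, e, Set.ncard_empty]

lemma paths_corner (n : ℕ) : paths n (2 ^ n, 0) = full n ∧ paths n (0, 2 ^ n) = full n := by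
  have hN : (0 : ℤ) < 2 ^ n := by positivity
  rw [paths, paths, ← ncard_mids (by simp [hN.ne]), ← ncard_mids (by simp [hN.ne])]
  exact ⟨rfl, (full_corners n).2.1⟩

lemma pairs_mul_full {m : ℕ} {x : ℤ × ℤ} (hx : x ∈ Site m) (k : ℕ) :
    x ∈ Site (m + k) ∧ pairs (m + k) x * full m = pairs m x * full (m + k) := by
  induction k with
  | zero => exact ⟨hx, rfl⟩
  | succ k ih =>
    refine ⟨.inl (.inl ih.1), ?_⟩
    rw [← add_assoc, pairs_succ ih.1, full_succ]
    linear_combination (2 * full (m + k) * miss (m + k)) * ih.2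

lemma paths_ratio {m n : ℕ} {x : ℤ × ℤ} (hx : x ∈ Site m) (hm : m ≤ n + 1) :
    (paths (n + 2) x / full (n + 2) : ℝ) = (pairs m x + pairs m x.swap) / (3 * full m) := by
  obtain ⟨k, hk⟩ := Nat.exists_eq_add_of_le hm
  have h1 := pairs_mul_full hx k
  have h2 := pairs_mul_full (site_swap.2 hx) k
  rw [← hk] at h1 h2
  have h3 : (pairs (n + 1) x * full m : ℝ) = pairs m x * full (n + 1) := by exact_mod_cast h1.2
  have h4 : (pairs (n + 1) x.swap * full m : ℝ) = pairs m x.swap * full (n + 1) := by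
    exact_mod_cast h2.2
  have h5 : (2 * miss (n + 1) : ℝ) = 3 * full (n + 1) := by exact_mod_cast two_mul_miss_succ n
  have h6 : (0 : ℝ) < full m := by exact_mod_cast (full_pos_and_miss_pos m).1
  have h7 : (0 : ℝ) < full (n + 1) := by exact_mod_cast (full_pos_and_miss_pos (n + 1)).1
  have h8 : (0 : ℝ) < full (n + 2) := by exact_mod_cast (full_pos_and_miss_pos (n + 2)).1
  rw [div_eq_div_iff h8.ne' (by positivity), paths_succ h1.1, full_succ (n + 1)]
  push_cast
  linear_combination 3 * (full (n + 1) : ℝ) ^ 2 * (h3 + h4) -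
    (full (n + 1) : ℝ) ^ 2 * (pairs m x + pairs m x.swap) * h5

lemma paths_axis {m n : ℕ} (hm : m ≤ n + 1) :
    (paths (n + 2) (2 ^ m, 0) / full (n + 2) : ℝ) = (if m = 0 then 1 / 3 else 1 / 2) ∧
    (paths (n + 2) (0, 2 ^ m) / full (n + 2) : ℝ) = (if m = 0 then 1 / 3 else 1 / 2) := by
  have key : ((miss m : ℝ) / (3 * full m)) = if m = 0 then 1 / 3 else 1 / 2 := by
    have h6 : (0 : ℝ) < full m := by exact_mod_cast (full_pos_and_miss_pos m).1
    cases m with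
    | zero => simp [full_zero, miss_zero]
    | succ k =>
      have h5 : (2 * miss (k + 1) : ℝ) = 3 * full (k + 1) := by exact_mod_cast two_mul_miss_succ k
      rw [if_neg (by simp), div_eq_div_iff (by positivity) (by norm_num)]
      linear_combination h5
  rw [paths_ratio (site_corner m).2.1 hm, paths_ratio (site_corner m).2.2 hm, Prod.swap_prod_mk,
    Prod.swap_prod_mk, pairs_right, pairs_top, ← key]
  simp

lemma paths_junction {m n : ℕ} (hm : m ≤ n) :
    (paths (n + 2) (2 ^ m, 2 ^ m) / full (n + 2) : ℝ) = if m = 0 then 2 / 3 else 1 := by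
  have hx : ((2 : ℤ) ^ m, (2 : ℤ) ^ m) ∈ Site (m + 1) :=
    .inl (.inr (((ring_link m).top_right _).2 rfl).1)
  have h6 : (0 : ℝ) < full m := by exact_mod_cast (full_pos_and_miss_pos m).1
  have h7 : (0 : ℝ) < miss m := by exact_mod_cast (full_pos_and_miss_pos m).2
  rw [paths_ratio hx (by omega), Prod.swap_prod_mk, pairs_succ_junction, full_succ]
  push_cast
  cases m with
  | zero => norm_num [full_zero, miss_zero]
  | succ k =>
    have h5 : (2 * miss (k + 1) : ℝ) = 3 * full (k + 1) := by exact_mod_cast two_mul_miss_succ k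
    rw [if_neg (by simp), div_eq_one_iff_eq (by positivity)]
    linear_combination (2 * full (k + 1) * miss (k + 1) : ℝ) * h5

lemma sq3_pos : 0 < sq3 := Real.sqrt_pos.2 (by norm_num)

/-- The planar position of a lattice point. -/
def emb (x : ℤ × ℤ) : ℝ × ℝ := (x.1 + x.2 / 2, x.2 / 2 * sq3)

lemma emb_injective : emb.Injective := by
  intro x y h
  simp only [emb, Prod.mk.injEq] at h
  obtain ⟨h1, h2⟩ := h
  have h3 : (x.2 : ℝ) = y.2 := by
    have := mul_right_cancel₀ sq3_pos.ne' h2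
    linarith
  have h4 : (x.1 : ℝ) = y.1 := by rw [h3] at h1; linarith
  exact Prod.ext (by exact_mod_cast h4) (by exact_mod_cast h3)

lemma emb_add (x y : ℤ × ℤ) : emb (x + y) = emb x + emb y := by
  ext <;> simp [emb] <;> ring

lemma emb_origin : emb (0, 0) = o := by simp [emb, o]

lemma emb_right (m : ℕ) : emb (2 ^ m, 0) = a m := by simp [emb, a]

lemma emb_top (m : ℕ) : emb (0, 2 ^ m) = b m := by simp [emb, b]

lemma emb_junction (m : ℕ) : emb (2 ^ m, 2 ^ m) = c m := by
  ext <;> simp [emb, c]; ring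

lemma mem_image_add_right {t : ℤ × ℤ} {p : ℝ × ℝ} {U : Set (ℤ × ℤ)} :
    p ∈ (· + emb t) '' (emb '' U) ↔ p ∈ emb '' ((fun x ↦ x - t) ⁻¹' U) := by
  constructor
  · rintro ⟨_, ⟨x, hx, rfl⟩, rfl⟩
    exact ⟨x + t, by simpa using hx, emb_add x t⟩
  · rintro ⟨x, hx, rfl⟩
    exact ⟨_, ⟨x - t, hx, rfl⟩, by simp [← emb_add]⟩

lemma image_emb_site (n : ℕ) : V n = emb '' Site n := by
  induction n with
  | zero =>
    have : Site 0 = {(0, 0), (1, 0), (0, 1)} := by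
      ext ⟨i, j⟩
      simp only [site_zero, Set.mem_insert_iff, Set.mem_singleton_iff, Prod.mk.injEq]
      omega
    rw [this, Set.image_insert_eq, Set.image_insert_eq, Set.image_singleton, V,
      emb_origin, ← emb_right, ← emb_top]
    simp
  | succ n ih =>
    ext p
    rw [V, ih, ← emb_right, ← emb_top]
    simp only [Set.mem_union, mem_image_add_right, Site, Set.image_union]
    tauto

lemma edges_eq (n : ℕ) : E n = {e | ∃ x y, Link n x y ∧ e = s(emb x, emb y)} := by
  induction n with
  | zero =>
    ext e
    rw [E, ← emb_origin, ← emb_right, ← emb_top]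
    simp only [Set.mem_insert_iff, Set.mem_singleton_iff, Set.mem_ofPred_eq]
    constructor
    · rintro (rfl | rfl | rfl)
      · exact ⟨(0, 0), (1, 0), by simp [Link, site_zero], by simp⟩
      · exact ⟨(0, 0), (0, 1), by simp [Link, site_zero], by simp⟩
      · exact ⟨(1, 0), (0, 1), by simp [Link, site_zero], by simp⟩
    · rintro ⟨⟨i, j⟩, ⟨k, l⟩, ⟨h, h1, h2⟩, rfl⟩
      have hx : (i = 0 ∧ j = 0) ∨ (i = 1 ∧ j = 0) ∨ (i = 0 ∧ j = 1) := by
        simp only [site_zero] at h1; omega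
      have hy : (k = 0 ∧ l = 0) ∨ (k = 1 ∧ l = 0) ∨ (k = 0 ∧ l = 1) := by
        simp only [site_zero] at h2; omega
      rcases hx with ⟨rfl, rfl⟩ | ⟨rfl, rfl⟩ | ⟨rfl, rfl⟩ <;>
      rcases hy with ⟨rfl, rfl⟩ | ⟨rfl, rfl⟩ | ⟨rfl, rfl⟩ <;>
      simp [Sym2.eq_swap] at h ⊢
  | succ n ih =>
    have key (t : ℤ × ℤ) : Sym2.map (· + emb t) '' E n =
        {e | ∃ x y, Link n (x - t) (y - t) ∧ e = s(emb x, emb y)} := by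
      rw [ih]
      ext e
      constructor
      · rintro ⟨_, ⟨x, y, h, rfl⟩, rfl⟩
        exact ⟨x + t, y + t, by simpa using h, by simp [emb_add]⟩
      · rintro ⟨x, y, h, rfl⟩
        exact ⟨_, ⟨x - t, y - t, h, rfl⟩, by simp [← emb_add]⟩
    rw [E, ← emb_right, ← emb_top, key, key, ih]
    ext e
    simp only [Set.mem_union, Set.mem_ofPred_eq, Link]
    grind

lemma adj_emb (n : ℕ) (x y : ℤ × ℤ) : (G n).Adj (emb x) (emb y) ↔ Link n x y := by
  rw [G, SimpleGraph.fromEdgeSet_adj, edges_eq]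
  constructor
  · rintro ⟨⟨z, w, h, he⟩, -⟩
    rw [Sym2.eq_iff] at he
    obtain ⟨h1, h2⟩ | ⟨h1, h2⟩ := he
    · rwa [emb_injective h1, emb_injective h2]
    · rw [emb_injective h1, emb_injective h2]; exact link_symm h
  · exact fun h ↦ ⟨⟨x, y, h, rfl⟩, emb_injective.ne (link_ne h)⟩

lemma exists_walk_support {α : Type*} {K : SimpleGraph α} {u v : α} {l : List α}
    (h : (u :: l).IsChain K.Adj) (hv : (u :: l).getLast? = some v) :
    ∃ w : K.Walk u v, w.support = u :: l := by
  rw [List.getLast?_eq_some_getLast (List.cons_ne_nil u l), Option.some_inj] at hv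
  subst hv
  exact ⟨SimpleGraph.Walk.ofSupport (u :: l) (List.cons_ne_nil u l) h,
    SimpleGraph.Walk.support_ofSupport _ h⟩

lemma f_eq_ncard_tails (n : ℕ) (u v : ℝ × ℝ) : f n u v = (Tails (G n).Adj u v (V n)).ncard := by
  rw [f, ← Nat.card_coe_set_eq]
  refine Nat.card_eq_of_bijective (fun w ↦ ⟨w.1.support.tail, ?_⟩) ⟨?_, ?_⟩
  · have := w.1.isChain_adj_support
    have h2 := w.2.1.support_nodup
    have h3 := w.2.2
    have h4 : w.1.support.getLast? = some v := by
      rw [List.getLast?_eq_some_getLast w.1.support_ne_nil, w.1.getLast_support]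
    rw [← w.1.cons_tail_support] at this h2 h3 h4
    exact ⟨this, h2, h3, h4⟩
  · intro w w' h
    have h' := congrArg Subtype.val h
    apply Subtype.ext
    apply SimpleGraph.Walk.ext_support
    rw [← w.1.cons_tail_support, ← w'.1.cons_tail_support]
    exact congrArg _ h'
  · rintro ⟨l, h1, h2, h3, h4⟩
    obtain ⟨w, hw⟩ := exists_walk_support h1 h4
    refine ⟨⟨w, ?_, fun x ↦ by rw [hw]; exact h3 x⟩, Subtype.ext (congrArg List.tail hw)⟩
    rw [SimpleGraph.Walk.isPath_def, hw]
    exact h2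

lemma f_emb {n : ℕ} {x : ℤ × ℤ} (hx : x ≠ (0, 0)) : f n o (emb x) = paths n x := by
  rw [f_eq_ncard_tails, paths, image_emb_site, ← emb_origin,
    ← ncard_mids (emb_injective.ne hx.symm), ncard_mids_map emb_injective,
    ← ncard_mids hx.symm]
  simp only [adj_emb]

lemma F_emb {n : ℕ} {x : ℤ × ℤ} (hx : x ≠ (0, 0)) :
    F n (emb x) = (paths n x / full n : ℝ) := by
  rw [F, f1, f_emb hx, ← emb_right, f_emb (by simp), (paths_corner n).1]

lemma sum_corners (n : ℕ) (g : ℝ × ℝ → ℝ) : ∑ x ∈ C n, g x =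
    ∑ j ∈ Finset.range (n + 1), g (a j) + ∑ j ∈ Finset.range (n + 1), g (b j) +
      ∑ j ∈ Finset.range n, g (c j) := by
  have hpow (m : ℕ) : 0 ≠ (2 : ℤ) ^ m := (pow_ne_zero m two_ne_zero).symm
  have hinj (i j : ℕ) (h : (2 : ℤ) ^ i = 2 ^ j) : i = j :=
    Int.pow_right_injective (le_refl 2) h
  have hab (i j : ℕ) : a i ≠ b j := by
    rw [← emb_right, ← emb_top]
    exact emb_injective.ne (by simp)
  have hac (i j : ℕ) : a i ≠ c j := by
    rw [← emb_right, ← emb_junction]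
    exact emb_injective.ne (by simp [hpow])
  have hbc (i j : ℕ) : b i ≠ c j := by
    rw [← emb_top, ← emb_junction]
    exact emb_injective.ne (by simp [hpow])
  have ha : a.Injective := fun i j h ↦ by
    rw [← emb_right, ← emb_right] at h
    exact hinj i j (congrArg Prod.fst (emb_injective h))
  have hb : b.Injective := fun i j h ↦ by
    rw [← emb_top, ← emb_top] at h
    exact hinj i j (congrArg Prod.snd (emb_injective h))
  have hc : c.Injective := fun i j h ↦ by
    rw [← emb_junction, ← emb_junction] at h
    exact hinj i j (congrArg Prod.fst (emb_injective h))
  rw [C, Finset.sum_union, Finset.sum_union, Finset.sum_image ha.injOn,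
    Finset.sum_image hb.injOn, Finset.sum_image hc.injOn]
  · simp only [Finset.disjoint_left, Finset.mem_image]
    rintro _ ⟨i, -, rfl⟩ ⟨j, -, h⟩
    exact hab i j h.symm
  · simp only [Finset.disjoint_left, Finset.mem_union, Finset.mem_image]
    rintro _ (⟨i, -, rfl⟩ | ⟨i, -, rfl⟩) ⟨j, -, h⟩
    · exact hac i j h.symm
    · exact hbc i j h.symm

lemma F_axis {m n : ℕ} (hm : m ≤ n + 1) :
    F (n + 2) (a m) = (if m = 0 then 1 / 3 else 1 / 2) ∧
      F (n + 2) (b m) = (if m = 0 then 1 / 3 else 1 / 2) := by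
  rw [← emb_right, ← emb_top, F_emb (by simp), F_emb (by simp)]
  exact paths_axis hm

lemma F_outer (n : ℕ) : F n (a n) = 1 ∧ F n (b n) = 1 := by
  have h : (full n : ℝ) ≠ 0 := by exact_mod_cast (full_pos_and_miss_pos n).1.ne'
  rw [← emb_right, ← emb_top, F_emb (by simp), F_emb (by simp), (paths_corner n).1,
    (paths_corner n).2]
  exact ⟨div_self h, div_self h⟩

lemma F_junction {m n : ℕ} (hm : m ≤ n) :
    F (n + 2) (c m) = if m = 0 then 2 / 3 else 1 := by
  rw [← emb_junction, F_emb (by simp)]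
  exact paths_junction hm

lemma F_succ_junction (n : ℕ) : F (n + 1) (c n) = 0 := by
  rw [← emb_junction, F_emb (by simp), paths_succ_junction]
  simp

lemma sum_range_add_two (k : ℕ) (g : ℕ → ℝ) : ∑ j ∈ Finset.range (k + 2), g j =
    g 0 + ∑ j ∈ Finset.range k, g (j + 1) + g (k + 1) := by
  rw [Finset.sum_range_succ, Finset.sum_range_succ']
  ring

/-- A weighted sum of the distribution ratios over the corner vertices. -/
lemma sum_corners_F (n : ℕ) (g : ℝ × ℝ → ℝ) : ∑ x ∈ C (n + 2), g x * F (n + 2) x =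
    (g (a 0) + g (b 0)) / 3 + (∑ j ∈ Finset.range (n + 1), (g (a (j + 1)) + g (b (j + 1)))) / 2 +
      (g (a (n + 2)) + g (b (n + 2))) + g (c 0) * (2 / 3) +
      ∑ j ∈ Finset.range n, g (c (j + 1)) := by
  have h1 : ∑ j ∈ Finset.range (n + 1), g (a (j + 1)) * F (n + 2) (a (j + 1)) =
      (∑ j ∈ Finset.range (n + 1), g (a (j + 1))) / 2 := by
    rw [Finset.sum_div]
    refine Finset.sum_congr rfl fun j hj ↦ ?_
    rw [(F_axis (by simpa [Nat.lt_succ_iff] using hj)).1]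
    simp [div_eq_mul_inv]
  have h2 : ∑ j ∈ Finset.range (n + 1), g (b (j + 1)) * F (n + 2) (b (j + 1)) =
      (∑ j ∈ Finset.range (n + 1), g (b (j + 1))) / 2 := by
    rw [Finset.sum_div]
    refine Finset.sum_congr rfl fun j hj ↦ ?_
    rw [(F_axis (by simpa [Nat.lt_succ_iff] using hj)).2]
    simp [div_eq_mul_inv]
  have h3 : ∑ j ∈ Finset.range n, g (c (j + 1)) * F (n + 2) (c (j + 1)) =
      ∑ j ∈ Finset.range n, g (c (j + 1)) := by
    refine Finset.sum_congr rfl fun j hj ↦ ?_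
    rw [F_junction (Nat.succ_le_of_lt (Finset.mem_range.1 hj))]
    simp
  rw [sum_corners, sum_range_add_two (n + 1), sum_range_add_two (n + 1), sum_range_add_two n,
    h1, h2, h3, (F_axis (Nat.zero_le _)).1, (F_axis (Nat.zero_le _)).2, (F_outer (n + 2)).1,
    (F_outer (n + 2)).2, F_junction (Nat.zero_le n), F_succ_junction, Finset.sum_add_distrib]
  simp only [if_true]
  ring

lemma enorm_corners (m : ℕ) :
    enorm (a m) = 2 ^ m ∧ enorm (b m) = 2 ^ m ∧ enorm (c m) = √3 * 2 ^ m := by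
  have h3 : sq3 ^ 2 = 3 := Real.sq_sqrt (by norm_num)
  refine ⟨?_, ?_, ?_⟩ <;> rw [enorm, Real.sqrt_eq_iff_mul_self_eq (by positivity) (by positivity)]
  · simp [a, sq]
  · simp only [b, mul_pow, h3]; ring
  · rw [mul_mul_mul_comm, Real.mul_self_sqrt (by norm_num)]
    simp only [c, mul_pow, h3]; ring

lemma xi'_add_two (n : ℕ) (ℓ : ℝ) {x s : ℝ} (hx : x = 2 ^ ℓ) (hs : s = √3 ^ ℓ) :
    xi' (n + 2) ℓ = (2 / 3 + ∑ j ∈ Finset.range (n + 1), x ^ (j + 1) + 2 * x ^ (n + 2) +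
      s * (2 / 3 + ∑ j ∈ Finset.range n, x ^ (j + 1))) / (2 * n + 13 / 3) := by
  have hden := sum_corners_F n fun _ ↦ 1
  simp only [one_mul] at hden
  have hpow (m : ℕ) : ((2 : ℝ) ^ m) ^ ℓ = x ^ m := by
    rw [hx, Real.rpow_pow_comm (by norm_num)]
  rw [xi', sum_corners_F n fun x ↦ enorm x ^ ℓ, hden]
  simp only [enorm_corners, Real.mul_rpow (Real.sqrt_nonneg 3) (pow_nonneg zero_le_two _),
    hpow, ← hs]
  congr 1
  · rw [← Finset.mul_sum, Finset.sum_add_distrib]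
    ring
  · simp
    ring

lemma sum_pow_succ_div {x : ℝ} (hx : 1 < x) (n : ℕ) :
    (∑ j ∈ Finset.range n, x ^ (j + 1)) / x ^ n = x * (1 - x⁻¹ ^ n) / (x - 1) := by
  have h0 : x ^ n ≠ 0 := by positivity
  have h1 : x - 1 ≠ 0 := by linarith
  simp only [pow_succ, ← Finset.sum_mul]
  rw [geom_sum_eq hx.ne', inv_pow]
  field_simp

lemma tendsto_sum_pow_succ_div {x : ℝ} (hx : 1 < x) :
    Tendsto (fun n : ℕ ↦ (∑ j ∈ Finset.range n, x ^ (j + 1)) / x ^ n) atTop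
      (𝓝 (x / (x - 1))) := by
  have h := tendsto_pow_atTop_nhds_zero_of_lt_one (r := x⁻¹) (by positivity)
    (inv_lt_one_of_one_lt₀ hx)
  simp only [sum_pow_succ_div hx]
  simpa using ((h.const_sub 1).const_mul x).div_const (x - 1)

lemma tendsto_ratio :
    Tendsto (fun n : ℕ ↦ ((n + 2 : ℕ) : ℝ) / (2 * n + 13 / 3)) atTop (𝓝 (1 / 2)) := by
  have h := tendsto_one_div_atTop_nhds_zero_nat (𝕜 := ℝ)
  have h2 : Tendsto (fun n : ℕ ↦ (1 + 2 * (1 / (n : ℝ))) / (2 + 13 / 3 * (1 / (n : ℝ)))) atTop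
      (𝓝 ((1 + 2 * 0) / (2 + 13 / 3 * 0))) :=
    ((h.const_mul 2).const_add 1).div ((h.const_mul (13 / 3)).const_add 2) (by norm_num)
  simp only [mul_zero, add_zero] at h2
  refine h2.congr' ?_
  filter_upwards [eventually_gt_atTop 0] with n hn
  have : (0 : ℝ) < n := by exact_mod_cast hn
  push_cast
  field_simp

/-- asymptotics of the mean `ℓ` displacement over the corner
vertices. -/
theorem xi_corner_asymptotics : ∀ ℓ : ℝ, 0 < ℓ →
    Filter.Tendsto (fun n : ℕ => (n : ℝ) * xi' n ℓ / (2 : ℝ) ^ ((n : ℝ) * ℓ))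
      Filter.atTop
      (nhds (1 + (1 + (Real.sqrt 3 / 2) ^ ℓ) / (2 * ((2 : ℝ) ^ ℓ - 1)))) := by
  intro ℓ hℓ
  obtain ⟨x, hx⟩ : ∃ x : ℝ, x = 2 ^ ℓ := ⟨_, rfl⟩
  obtain ⟨s, hs⟩ : ∃ s : ℝ, s = √3 ^ ℓ := ⟨_, rfl⟩
  have hx1 : 1 < x := hx ▸ Real.one_lt_rpow (by norm_num) hℓ
  have hx0 : 0 < x := by linarith
  have hd : x - 1 ≠ 0 := by linarith
  rw [Real.div_rpow (Real.sqrt_nonneg 3) zero_le_two, ← hx, ← hs,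
    ← tendsto_add_atTop_iff_nat 2]
  have hinv : Tendsto (fun n : ℕ ↦ x⁻¹ ^ (n + 2)) atTop (𝓝 0) :=
    (tendsto_add_atTop_iff_nat 2).2 <|
      tendsto_pow_atTop_nhds_zero_of_lt_one (by positivity) (inv_lt_one_of_one_lt₀ hx1)
  have hgeom := tendsto_sum_pow_succ_div hx1
  have hnum := (((hinv.const_mul (2 / 3 * (1 + s))).add
    (((tendsto_add_atTop_iff_nat 1).2 hgeom).const_mul x⁻¹)).add_const 2).add
    (hgeom.const_mul (s / x ^ 2))
  convert tendsto_ratio.mul hnum using 2 with n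
  · rw [xi'_add_two n ℓ hx hs, mul_comm _ ℓ, Real.rpow_mul_natCast zero_le_two, ← hx, inv_pow]
    have : (2 * n + 13 / 3 : ℝ) ≠ 0 := by positivity
    field_simp
    ring
  · field_simp
    ring

end SierpinskiGasket
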